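/- arXiv:2012.00980 — 7 statements merged into one kernel-verified Lean document; each statement's English description precedes it below -/
import Mathlib

section
/- Let d ≥ 1, σ > 0, m ∈ ℝ^d, and let Σ be a d×d symmetric positive-definite matrix. For the Gaussian kernel k_σ on ℝ^d, MMD_{k_σ}(N(0,I_d), N(m,Σ))² = (1+4σ)^{-d/2} + det(I_d+4σΣ)^{-1/2} − 2·det((1+2σ)I_d+2σΣ)^{-1/2}·exp(−σ·mᵀ((1+2σ)I_d+2σΣ)⁻¹m). -/
open MeasureTheory Matrix

/-- The Gaussian measure `N(m, S)` on `ℝ^d`, defined by its density with respect to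
Lebesgue measure. -/
noncomputable def gaussianMeasure {d : ℕ} (m : Fin d → ℝ) (S : Matrix (Fin d) (Fin d) ℝ) :
    Measure (Fin d → ℝ) :=
  volume.withDensity fun x =>
    ENNReal.ofReal (((2 * Real.pi) ^ d * S.det) ^ (-(1 : ℝ) / 2) *
      Real.exp (-(1 / 2) * ((x - m) ⬝ᵥ (S⁻¹ *ᵥ (x - m)))))

/-- The Gaussian kernel `k_σ(x,y) = exp(-σ‖x-y‖²)` on `ℝ^d`. -/
noncomputable def gaussKernel {d : ℕ} (σ : ℝ) (x y : Fin d → ℝ) : ℝ :=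
  Real.exp (-σ * ∑ i, (x i - y i) ^ 2)

/-- Squared maximum mean discrepancy. -/
noncomputable def mmdSq {α : Type*} [MeasurableSpace α] (k : α → α → ℝ) (P Q : Measure α) : ℝ :=
  (∫ x, ∫ y, k x y ∂P ∂P) + (∫ x, ∫ y, k x y ∂Q ∂Q) - 2 * ∫ x, ∫ y, k x y ∂Q ∂P

open scoped MatrixOrder in
lemma aux_gauss_int {d : ℕ} (A : Matrix (Fin d) (Fin d) ℝ) (hA : A.PosDef) :
    ∫ v : Fin d → ℝ, Real.exp (-(1 / 2) * (v ⬝ᵥ (A *ᵥ v)))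
      = ((2 * Real.pi) ^ d / A.det) ^ ((1 : ℝ) / 2) := by
  obtain ⟨B, hB⟩ := CStarAlgebra.nonneg_iff_eq_star_mul_self.mp hA.posSemidef.nonneg
  have hpos := hA.det_pos
  have hdet : A.det = B.det ^ 2 := by
    rw [hB, star_eq_conjTranspose, conjTranspose_eq_transpose_of_trivial, det_mul, det_transpose, sq]
  have hBne : B.det ≠ 0 := by
    intro h; rw [hdet, h] at hpos; simp at hpos
  have hquad : ∀ v : Fin d → ℝ, v ⬝ᵥ (A *ᵥ v) = ∑ i, (toLin' B v i) ^ 2 := by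
    intro v
    rw [hB, star_eq_conjTranspose, conjTranspose_eq_transpose_of_trivial, ← mulVec_mulVec,
      dotProduct_mulVec, vecMul_transpose, toLin'_apply, dotProduct]
    exact Finset.sum_congr rfl fun i _ => (sq _).symm
  have hstd : ∫ w : Fin d → ℝ, Real.exp (-(1 / 2) * ∑ i, w i ^ 2) = √(2 * Real.pi) ^ d := by
    simp_rw [Finset.mul_sum, Real.exp_sum]
    rw [integral_fintype_prod_volume_eq_pow (fun t : ℝ => Real.exp (-(1 / 2) * t ^ 2)),
      integral_gaussian]
    simp [mul_comm]
  have hmap := integral_map (μ := (volume : Measure (Fin d → ℝ))) (φ := toLin' B)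
    (f := fun w : Fin d → ℝ => Real.exp (-(1 / 2) * ∑ i, w i ^ 2))
    (LinearMap.continuous_of_finiteDimensional _).aemeasurable
    (by apply Continuous.aestronglyMeasurable; fun_prop)
  rw [Real.map_matrix_volume_pi_eq_smul_volume_pi hBne, integral_smul_measure, hstd] at hmap
  simp_rw [hquad]
  rw [← hmap, ENNReal.toReal_ofReal (abs_nonneg _), ← Real.sqrt_eq_rpow, Real.sqrt_div (by positivity),
    hdet, Real.sqrt_sq_eq_abs, abs_inv, smul_eq_mul]
  have : √((2 * Real.pi) ^ d) = √(2 * Real.pi) ^ d := by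
    rw [Real.sqrt_eq_iff_eq_sq (by positivity) (by positivity), ← pow_mul, mul_comm d 2, pow_mul,
      Real.sq_sqrt (by positivity)]
  rw [this]; ring

lemma aux_symm {d : ℕ} {S : Matrix (Fin d) (Fin d) ℝ} (hS : S.PosDef) (x y : Fin d → ℝ) :
    x ⬝ᵥ (S *ᵥ y) = y ⬝ᵥ (S *ᵥ x) := by
  have h : Sᵀ = S := by
    have := hS.isHermitian.eq
    rwa [conjTranspose_eq_transpose_of_trivial] at this
  rw [dotProduct_mulVec, ← mulVec_transpose, h, dotProduct_comm]

lemma aux_unit {d : ℕ} {S : Matrix (Fin d) (Fin d) ℝ} (hS : S.PosDef) : IsUnit S.det :=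
  hS.det_pos.ne'.isUnit

lemma aux_square {d : ℕ} {S T : Matrix (Fin d) (Fin d) ℝ} (hS : S.PosDef) (hT : T.PosDef)
    (v w : Fin d → ℝ) :
    (v + S *ᵥ ((S + T)⁻¹ *ᵥ w) - w) ⬝ᵥ (T⁻¹ *ᵥ (v + S *ᵥ ((S + T)⁻¹ *ᵥ w) - w))
      + (v + S *ᵥ ((S + T)⁻¹ *ᵥ w)) ⬝ᵥ (S⁻¹ *ᵥ (v + S *ᵥ ((S + T)⁻¹ *ᵥ w)))
      = v ⬝ᵥ ((S⁻¹ + T⁻¹) *ᵥ v) + w ⬝ᵥ ((S + T)⁻¹ *ᵥ w) := by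
  have hST := hS.add hT
  set z := (S + T)⁻¹ *ᵥ w with hz
  have hw : w = S *ᵥ z + T *ᵥ z := by
    rw [← add_mulVec, hz, mulVec_mulVec, mul_nonsing_inv _ (aux_unit hST), one_mulVec]
  have e1 : v + S *ᵥ z - w = v - T *ᵥ z := by rw [hw]; abel
  have e2 : ∀ y, T⁻¹ *ᵥ (T *ᵥ y) = y := fun y => by
    rw [mulVec_mulVec, nonsing_inv_mul _ (aux_unit hT), one_mulVec]
  have e3 : ∀ y, S⁻¹ *ᵥ (S *ᵥ y) = y := fun y => by
    rw [mulVec_mulVec, nonsing_inv_mul _ (aux_unit hS), one_mulVec]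
  have e4 : (T *ᵥ z) ⬝ᵥ (T⁻¹ *ᵥ v) = v ⬝ᵥ z := by rw [aux_symm hT.inv, e2]
  have e5 : (S *ᵥ z) ⬝ᵥ (S⁻¹ *ᵥ v) = v ⬝ᵥ z := by rw [aux_symm hS.inv, e3]
  rw [e1, mulVec_sub, mulVec_add, e2, e3, add_mulVec]
  have e6 : w ⬝ᵥ z = (S *ᵥ z) ⬝ᵥ z + (T *ᵥ z) ⬝ᵥ z := by rw [← add_dotProduct, ← hw]
  rw [e6]
  simp only [sub_dotProduct, dotProduct_sub, add_dotProduct, dotProduct_add, e4, e5]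
  ring

lemma aux_det {d : ℕ} {S T : Matrix (Fin d) (Fin d) ℝ} (hS : S.PosDef) (hT : T.PosDef) :
    (S⁻¹ + T⁻¹).det = (S + T).det / (S.det * T.det) := by
  have h : S⁻¹ + T⁻¹ = S⁻¹ * (S + T) * T⁻¹ := by
    rw [mul_add, nonsing_inv_mul _ (aux_unit hS), add_mul, one_mul, mul_assoc,
      mul_nonsing_inv _ (aux_unit hT), mul_one, add_comm]
  rw [h, det_mul, det_mul, det_nonsing_inv, det_nonsing_inv, Ring.inverse_eq_inv']
  field_simp

lemma aux_L {d : ℕ} {S T : Matrix (Fin d) (Fin d) ℝ} (hS : S.PosDef) (hT : T.PosDef)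
    (a m : Fin d → ℝ) :
    ∫ x, Real.exp (-(1 / 2) * ((x - a) ⬝ᵥ (T⁻¹ *ᵥ (x - a)))) ∂(gaussianMeasure m S)
      = T.det ^ ((1 : ℝ) / 2) * (S + T).det ^ (-(1 : ℝ) / 2) *
        Real.exp (-(1 / 2) * ((a - m) ⬝ᵥ ((S + T)⁻¹ *ᵥ (a - m)))) := by
  have hSp := hS.det_pos
  have hTp := hT.det_pos
  have hSTp := (hS.add hT).det_pos
  unfold gaussianMeasure
  rw [integral_withDensity_eq_integral_toReal_smul]
  rotate_left
  · apply Measurable.ennreal_ofReal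
    apply Continuous.measurable
    fun_prop
  · exact Filter.Eventually.of_forall fun x => ENNReal.ofReal_lt_top
  rw [← integral_add_right_eq_self _ (m + S *ᵥ ((S + T)⁻¹ *ᵥ (a - m)))]
  have key : ∀ v : Fin d → ℝ, _ := fun v => aux_square hS hT v (a - m)
  set c := S *ᵥ ((S + T)⁻¹ *ᵥ (a - m)) with hc
  have : ∀ v : Fin d → ℝ,
      (ENNReal.ofReal (((2 * Real.pi) ^ d * S.det) ^ (-(1 : ℝ) / 2) *
        Real.exp (-(1 / 2) * ((v + (m + c) - m) ⬝ᵥ (S⁻¹ *ᵥ (v + (m + c) - m)))))).toReal •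
        Real.exp (-(1 / 2) * ((v + (m + c) - a) ⬝ᵥ (T⁻¹ *ᵥ (v + (m + c) - a))))
      = (((2 * Real.pi) ^ d * S.det) ^ (-(1 : ℝ) / 2) *
        Real.exp (-(1 / 2) * ((a - m) ⬝ᵥ ((S + T)⁻¹ *ᵥ (a - m))))) *
        Real.exp (-(1 / 2) * (v ⬝ᵥ ((S⁻¹ + T⁻¹) *ᵥ v))) := by
    intro v
    rw [ENNReal.toReal_ofReal (by positivity), smul_eq_mul, mul_assoc, mul_assoc, ← Real.exp_add,
      ← Real.exp_add]
    have h1 : v + (m + c) - m = v + c := by abel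
    have h2 : v + (m + c) - a = v + c - (a - m) := by abel
    rw [h1, h2, ← mul_add, ← mul_add, add_comm (_ ⬝ᵥ _), key, add_comm (_ ⬝ᵥ _)]
  simp_rw [this]
  rw [integral_const_mul, aux_gauss_int _ (hS.inv.add hT.inv), aux_det hS hT]
  have hc1 : ((2 * Real.pi) ^ d * S.det) ^ (-(1 : ℝ) / 2) *
      ((2 * Real.pi) ^ d / ((S + T).det / (S.det * T.det))) ^ ((1 : ℝ) / 2)
      = T.det ^ ((1 : ℝ) / 2) * (S + T).det ^ (-(1 : ℝ) / 2) := by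
    rw [neg_div, Real.rpow_neg (by positivity), ← Real.inv_rpow (by positivity),
      ← Real.mul_rpow (by positivity) (by positivity), Real.rpow_neg hSTp.le,
      ← Real.inv_rpow hSTp.le, ← Real.mul_rpow hTp.le (by positivity)]
    congr 1
    field_simp
  rw [← hc1]; ring

lemma aux_main {d : ℕ} {σ : ℝ} (hσ : 0 < σ) {S S' : Matrix (Fin d) (Fin d) ℝ} (hS : S.PosDef)
    (hS' : S'.PosDef) (m m' : Fin d → ℝ) :
    ∫ x, ∫ y, gaussKernel σ x y ∂(gaussianMeasure m S) ∂(gaussianMeasure m' S')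
      = (1 + (2 * σ) • (S + S')).det ^ (-(1 : ℝ) / 2) *
        Real.exp (-σ * ((m - m') ⬝ᵥ ((1 + (2 * σ) • (S + S'))⁻¹ *ᵥ (m - m')))) := by
  have hσ2 : (0 : ℝ) < (2 * σ)⁻¹ := by positivity
  set T : Matrix (Fin d) (Fin d) ℝ := (2 * σ)⁻¹ • 1 with hTdef
  have hT : T.PosDef := Matrix.PosDef.one.smul hσ2
  have hTinv : T⁻¹ = (2 * σ) • 1 := by
    apply inv_eq_left_inv
    rw [hTdef, smul_mul_smul_comm, mul_one, mul_inv_cancel₀ (by positivity), one_smul]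
  have hk : ∀ x y : Fin d → ℝ, gaussKernel σ x y
      = Real.exp (-(1 / 2) * ((y - x) ⬝ᵥ (T⁻¹ *ᵥ (y - x)))) := by
    intro x y
    rw [hTinv, smul_mulVec, one_mulVec, dotProduct_smul, gaussKernel, dotProduct, smul_eq_mul]
    congr 1
    have : ∑ i, (x i - y i) ^ 2 = ∑ i, (y - x) i * (y - x) i :=
      Finset.sum_congr rfl fun i _ => by simp only [Pi.sub_apply]; ring
    rw [this]; ring
  simp_rw [hk, aux_L hS hT]
  rw [integral_const_mul, aux_L hS' (hS.add hT)]
  have hA := hS'.add (hS.add hT)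
  have hM : (1 + (2 * σ) • (S + S')) = (2 * σ) • (S' + (S + T)) := by
    rw [hTdef, smul_add, smul_add, smul_add, smul_smul, mul_inv_cancel₀ (by positivity), one_smul]
    abel
  have hMinv : (S' + (S + T))⁻¹ = (2 * σ) • (1 + (2 * σ) • (S + S'))⁻¹ := by
    apply inv_eq_left_inv
    rw [smul_mul_assoc, ← mul_smul_comm, ← hM]
    apply nonsing_inv_mul
    rw [hM]
    exact aux_unit (hA.smul (by positivity : 0 < 2 * σ))
  have hMp : 0 < (1 + (2 * σ) • (S + S')).det := by
    rw [hM]; exact (hA.smul (by positivity : 0 < 2 * σ)).det_pos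
  have hd1 : T.det ^ ((1 : ℝ) / 2) * (S + T).det ^ (-(1 : ℝ) / 2) *
      ((S + T).det ^ ((1 : ℝ) / 2) * (S' + (S + T)).det ^ (-(1 : ℝ) / 2))
      = (1 + (2 * σ) • (S + S')).det ^ (-(1 : ℝ) / 2) := by
    have h1 := (hS.add hT).det_pos
    have h2 := hA.det_pos
    have h3 := hT.det_pos
    have h4 : (1 + (2 * σ) • (S + S')).det = (S' + (S + T)).det / T.det := by
      rw [hM, det_smul, hTdef, det_smul, det_one, mul_one, inv_pow]
      field_simp
    rw [h4, neg_div, Real.rpow_neg h1.le, Real.rpow_neg h2.le, Real.rpow_neg (by positivity),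
      Real.div_rpow h2.le h3.le]
    have := Real.rpow_pos_of_pos h1 (1 / 2)
    field_simp
  rw [← hd1, hMinv, smul_mulVec, dotProduct_smul, smul_eq_mul]
  have : -(1 / 2) * (2 * σ * ((m - m') ⬝ᵥ ((1 + (2 * σ) • (S + S'))⁻¹ *ᵥ (m - m'))))
    = -σ * ((m - m') ⬝ᵥ ((1 + (2 * σ) • (S + S'))⁻¹ *ᵥ (m - m'))) := by ring
  rw [this]; ring

theorem stmt0 (d : ℕ) (hd : 1 ≤ d) (σ : ℝ) (hσ : 0 < σ) (m : Fin d → ℝ)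
    (S : Matrix (Fin d) (Fin d) ℝ) (hSsym : S.IsSymm) (hSpd : S.PosDef) :
    mmdSq (gaussKernel σ) (gaussianMeasure 0 1) (gaussianMeasure m S) =
      (1 + 4 * σ) ^ (-(d : ℝ) / 2)
        + ((1 : Matrix (Fin d) (Fin d) ℝ) + (4 * σ) • S).det ^ (-(1 : ℝ) / 2)
        - 2 * ((1 + 2 * σ) • (1 : Matrix (Fin d) (Fin d) ℝ) + (2 * σ) • S).det ^ (-(1 : ℝ) / 2)
          * Real.exp (-σ *
              (m ⬝ᵥ (((1 + 2 * σ) • (1 : Matrix (Fin d) (Fin d) ℝ) + (2 * σ) • S)⁻¹ *ᵥ m))) := by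

  unfold mmdSq
  rw [aux_main hσ Matrix.PosDef.one Matrix.PosDef.one, aux_main hσ hSpd hSpd,
    aux_main hσ hSpd Matrix.PosDef.one]
  have e1 : (1 : Matrix (Fin d) (Fin d) ℝ) + (2 * σ) • (1 + 1) = (1 + 4 * σ) • 1 := by
    module
  have e2 : (1 : Matrix (Fin d) (Fin d) ℝ) + (2 * σ) • (S + S) = 1 + (4 * σ) • S := by
    module
  have e3 : (1 : Matrix (Fin d) (Fin d) ℝ) + (2 * σ) • (S + 1)
      = (1 + 2 * σ) • 1 + (2 * σ) • S := by
    module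
  have e4 : ((1 + 4 * σ) ^ d) ^ (-(1 : ℝ) / 2) = (1 + 4 * σ) ^ (-(d : ℝ) / 2) := by
    rw [← Real.rpow_natCast, ← Real.rpow_mul (by positivity)]
    congr 1
    ring
  rw [e1, e2, e3, det_smul, det_one, mul_one, Fintype.card_fin, e4]
  simp only [sub_self, sub_zero, zero_dotProduct, mul_zero, Real.exp_zero, mul_one]
  ring
end

section
/- Let d ≥ 1, σ > 0, m ∈ ℝ^d, and let Σ be a d×d symmetric positive-definite matrix. For the Gaussian kernel k_σ on ℝ^d, MVD_{k_σ}(N(0,I_d), N(m,Σ))² = (1+8σ)^{-d/2} − 2(1+8σ+12σ²)^{-d/2} + (1+4σ)^{-d} + det(I_d+8σΣ)^{-1/2} − 2·det(I_d+8σΣ+12σ²Σ²)^{-1/2} + det(I_d+4σΣ)^{-1} − 2·det((1+4σ)I_d+4σΣ)^{-1/2}·exp(−2σ·mᵀ((1+4σ)I_d+4σΣ)⁻¹m) + 2·det(I_d+2σΣ)^{-1/2}·det((1+4σ)I_d+2σΣ)^{-1/2}·exp(−2σ·mᵀ((1+4σ)I_d+2σΣ)⁻¹m) + 2(1+2σ)^{-d/2}·det((1+2σ)I_d+4σΣ)^{-1/2}·exp(−2σ·mᵀ((1+2σ)I_d+4σΣ)⁻¹m)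 − 2·det((1+2σ)I_d+2σΣ)^{-1}·exp(−2σ·mᵀ((1+2σ)I_d+2σΣ)⁻¹m). -/
open MeasureTheory Matrix

/-- `J_k(P,Q)`, the Hilbert–Schmidt inner product of the covariance operators of the kernel
features, expressed through integrals of the kernel. -/
noncomputable def Jk {α : Type*} [MeasurableSpace α] (k : α → α → ℝ) (P Q : Measure α) : ℝ :=
  (∫ x, ∫ y, (k x y) ^ 2 ∂Q ∂P) - (∫ x, (∫ y, k x y ∂Q) ^ 2 ∂P)
    - (∫ y, (∫ x, k x y ∂P) ^ 2 ∂Q) + (∫ x, ∫ y, k x y ∂Q ∂P) ^ 2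

/-- Squared maximum variance discrepancy. -/
noncomputable def mvdSq {α : Type*} [MeasurableSpace α] (k : α → α → ℝ) (P Q : Measure α) : ℝ :=
  Jk k P P + Jk k Q Q - 2 * Jk k P Q

open scoped MatrixOrder in
lemma posDef_factor {d : ℕ} {B : Matrix (Fin d) (Fin d) ℝ} (hB : B.PosDef) :
    ∃ C : Matrix (Fin d) (Fin d) ℝ, Cᵀ * C = B := by
  refine ⟨CFC.sqrt B, ?_⟩
  have h : (CFC.sqrt B)ᴴ = CFC.sqrt B := (CFC.sqrt_nonneg B).isSelfAdjoint
  rw [conjTranspose_eq_transpose_of_trivial] at h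
  rw [h, CFC.sqrt_mul_sqrt_self _ hB.posSemidef.nonneg]

lemma std_integral (d : ℕ) :
    ∫ x : Fin d → ℝ, Real.exp (-(1/2) * (x ⬝ᵥ x)) = ((2 * Real.pi) ^ d) ^ ((1:ℝ)/2) := by
  have h : ∀ x : Fin d → ℝ, Real.exp (-(1/2) * (x ⬝ᵥ x))
      = ∏ i, Real.exp (-(1/2) * (x i)^2) := by
    intro x
    rw [← Real.exp_sum, dotProduct, Finset.mul_sum]
    simp only [pow_two]
  simp_rw [h]
  rw [integral_fintype_prod_volume_eq_prod (f := fun _ (y:ℝ) => Real.exp (-(1/2) * y^2))]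
  simp only [integral_gaussian, Finset.prod_const, Finset.card_univ, Fintype.card_fin]
  rw [Real.sqrt_eq_rpow, ← Real.rpow_natCast, ← Real.rpow_natCast, ← Real.rpow_mul (by positivity),
    ← Real.rpow_mul (by positivity)]
  congr 1 <;> ring

lemma gauss_integral {d : ℕ} {B : Matrix (Fin d) (Fin d) ℝ} (hB : B.PosDef) :
    ∫ x : Fin d → ℝ, Real.exp (-(1/2) * (x ⬝ᵥ (B *ᵥ x)))
      = ((2 * Real.pi) ^ d) ^ ((1:ℝ)/2) * B.det ^ (-(1:ℝ)/2) := by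
  obtain ⟨C, hC⟩ := posDef_factor hB
  have hdet : B.det = C.det ^ 2 := by rw [← hC, det_mul, det_transpose, pow_two]
  have hC0 : C.det ≠ 0 := by
    intro h
    have := hB.det_pos
    rw [hdet, h] at this
    simp at this
  have hq : ∀ x : Fin d → ℝ, x ⬝ᵥ (B *ᵥ x) = (toLin' C x) ⬝ᵥ (toLin' C x) := by
    intro x
    rw [← hC, toLin'_apply, ← mulVec_mulVec, dotProduct_mulVec, vecMul_transpose]
  simp_rw [hq]
  have hm : Measurable (toLin' C) := (LinearMap.continuous_of_finiteDimensional _).measurable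
  rw [← integral_map (φ := toLin' C) (f := fun y => Real.exp (-(1/2) * (y ⬝ᵥ y))) hm.aemeasurable
    (by apply Continuous.aestronglyMeasurable; fun_prop),
    Real.map_matrix_volume_pi_eq_smul_volume_pi hC0, integral_smul_measure, std_integral,
    ENNReal.toReal_ofReal (abs_nonneg _), smul_eq_mul, mul_comm]
  congr 1
  rw [hdet, ← sq_abs, ← Real.rpow_natCast, ← Real.rpow_mul (abs_nonneg _), abs_inv]
  norm_num
  rw [Real.rpow_neg_one]

lemma complete_square {d : ℕ} {S A : Matrix (Fin d) (Fin d) ℝ} (hS : S.PosDef) (hA : A.PosDef)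
    (t : ℝ) (v w : Fin d → ℝ) :
    (v + t • (S *ᵥ w)) ⬝ᵥ (S⁻¹ *ᵥ (v + t • (S *ᵥ w)))
      + t * ((v - A *ᵥ w) ⬝ᵥ (A⁻¹ *ᵥ (v - A *ᵥ w)))
    = v ⬝ᵥ ((S⁻¹ + t • A⁻¹) *ᵥ v) + t * (w ⬝ᵥ ((A + t • S) *ᵥ w)) := by
  have sS : S⁻¹ * S = 1 := nonsing_inv_mul _ hS.det_pos.ne'.isUnit
  have sA : A⁻¹ * A = 1 := nonsing_inv_mul _ hA.det_pos.ne'.isUnit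
  have tS : Sᵀ = S := by simpa using hS.isHermitian.eq
  have tA : Aᵀ = A := by simpa using hA.isHermitian.eq
  have key : ∀ M : Matrix (Fin d) (Fin d) ℝ, M⁻¹ * M = 1 → Mᵀ = M → 
      (M *ᵥ w) ⬝ᵥ (M⁻¹ *ᵥ v) = v ⬝ᵥ w := by
    intro M h1 h2
    have : (M⁻¹)ᵀ = M⁻¹ := by rw [transpose_nonsing_inv, h2]
    rw [dotProduct_mulVec, ← mulVec_transpose, this, mulVec_mulVec, h1, one_mulVec, dotProduct_comm]
  have k1 := key S sS tS
  have k2 := key A sA tA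
  simp only [mulVec_add, mulVec_sub, mulVec_smul, mulVec_mulVec, sS, sA, one_mulVec,
    add_dotProduct, sub_dotProduct, dotProduct_add, dotProduct_sub, smul_dotProduct, dotProduct_smul,
    add_mulVec, smul_mulVec, smul_eq_mul, k1, k2, dotProduct_comm (_ *ᵥ w) w]
  ring

lemma key_integral {d : ℕ} {S A : Matrix (Fin d) (Fin d) ℝ} (hS : S.PosDef) (hA : A.PosDef)
    (m a : Fin d → ℝ) (c : ℝ) (hc : 0 < c) :
    ∫ x, Real.exp (-c * ((x - a) ⬝ᵥ (A⁻¹ *ᵥ (x - a)))) ∂(gaussianMeasure m S)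
      = A.det ^ ((1:ℝ)/2) * (A + (2 * c) • S).det ^ (-(1:ℝ)/2)
        * Real.exp (-c * ((a - m) ⬝ᵥ ((A + (2 * c) • S)⁻¹ *ᵥ (a - m)))) := by
  have hT : (A + (2 * c) • S).PosDef := hA.add (hS.smul (by positivity))
  have hB : (S⁻¹ + (2 * c) • A⁻¹).PosDef := hS.inv.add (hA.inv.smul (by positivity))
  set T := A + (2 * c) • S with hTdef
  set B := S⁻¹ + (2 * c) • A⁻¹ with hBdef
  have dS := hS.det_pos
  have dA := hA.det_pos
  have dT := hT.det_pos
  have dB := hB.det_pos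
  have hTT : T * T⁻¹ = 1 := mul_nonsing_inv _ dT.ne'.isUnit
  have hBdet : B.det = S.det⁻¹ * T.det * A.det⁻¹ := by
    have : B = S⁻¹ * T * A⁻¹ := by
      rw [hTdef, hBdef, mul_add, add_mul, mul_assoc, mul_nonsing_inv _ dA.ne'.isUnit, mul_one,
        Matrix.mul_smul, Matrix.smul_mul, nonsing_inv_mul _ dS.ne'.isUnit, one_mul]
    rw [this, det_mul, det_mul, det_nonsing_inv, det_nonsing_inv]
    simp
  set w := T⁻¹ *ᵥ (a - m) with hw
  have hTw : T *ᵥ w = a - m := by rw [hw, mulVec_mulVec, hTT, one_mulVec]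
  have hsum : a - m = A *ᵥ w + (2 * c) • (S *ᵥ w) := by
    rw [← hTw, hTdef, add_mulVec, smul_mulVec]
  rw [gaussianMeasure, integral_withDensity_eq_integral_toReal_smul]
  rotate_left
  · apply Measurable.ennreal_ofReal
    apply Continuous.measurable
    fun_prop
  · exact Filter.Eventually.of_forall fun x => ENNReal.ofReal_lt_top
  set K := ((2 * Real.pi) ^ d * S.det) ^ (-(1 : ℝ) / 2) with hK
  have hpt : ∀ x : Fin d → ℝ, (ENNReal.ofReal (K *
      Real.exp (-(1 / 2) * ((x - m) ⬝ᵥ (S⁻¹ *ᵥ (x - m)))))).toReal •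
        Real.exp (-c * ((x - a) ⬝ᵥ (A⁻¹ *ᵥ (x - a))))
      = (K * Real.exp (-c * ((a - m) ⬝ᵥ w))) *
        (fun v => Real.exp (-(1/2) * (v ⬝ᵥ (B *ᵥ v)))) (x - (m + (2 * c) • (S *ᵥ w))) := by
    intro x
    rw [ENNReal.toReal_ofReal (by positivity), smul_eq_mul, mul_assoc, mul_assoc, ← Real.exp_add]
    dsimp only
    rw [← Real.exp_add]
    congr 2
    have h := complete_square hS hA (2 * c) (x - (m + (2 * c) • (S *ᵥ w))) w
    have e1 : x - (m + (2 * c) • (S *ᵥ w)) + (2 * c) • (S *ᵥ w) = x - m := by abel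
    have e2 : x - (m + (2 * c) • (S *ᵥ w)) - A *ᵥ w = x - a := by
      have : a = m + (A *ᵥ w + (2 * c) • (S *ᵥ w)) := by rw [← hsum]; abel
      calc _ = x - (m + (A *ᵥ w + (2 * c) • (S *ᵥ w))) := by abel
        _ = x - a := by rw [← this]
    rw [e1, e2, ← hTdef, ← hBdef, hTw, dotProduct_comm w] at h
    linarith
  simp_rw [hpt]
  rw [integral_const_mul, integral_sub_right_eq_self (fun v => Real.exp (-(1/2) * (v ⬝ᵥ (B *ᵥ v)))),
    gauss_integral hB, hBdet, hK]
  have hp : (0:ℝ) < (2 * Real.pi) ^ d := by positivity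
  rw [Real.mul_rpow hp.le dS.le, Real.mul_rpow (by positivity) (by positivity),
    Real.mul_rpow (by positivity) dT.le, Real.inv_rpow dS.le, Real.inv_rpow dA.le]
  simp only [neg_div, Real.rpow_neg dS.le, Real.rpow_neg dA.le, Real.rpow_neg hp.le, inv_inv]
  have n1 := (Real.rpow_pos_of_pos dS (1/2)).ne'
  have n2 := (Real.rpow_pos_of_pos hp (1/2)).ne'
  field_simp

lemma kernel_eq {d : ℕ} (σ : ℝ) (x y : Fin d → ℝ) :
    gaussKernel σ x y = Real.exp (-σ * ((y - x) ⬝ᵥ ((1 : Matrix (Fin d) (Fin d) ℝ)⁻¹ *ᵥ (y - x)))) := by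
  rw [gaussKernel, inv_one, one_mulVec, dotProduct]
  congr 2
  apply Finset.sum_congr rfl
  intros
  simp only [Pi.sub_apply]
  ring

lemma kernel_symm {d : ℕ} (σ : ℝ) (x y : Fin d → ℝ) : gaussKernel σ x y = gaussKernel σ y x := by
  rw [gaussKernel, gaussKernel]
  congr 2
  apply Finset.sum_congr rfl
  intros
  ring

lemma kernel_sq {d : ℕ} (σ : ℝ) (x y : Fin d → ℝ) :
    gaussKernel σ x y ^ 2 = gaussKernel (2 * σ) x y := by
  rw [gaussKernel, gaussKernel, ← Real.exp_nat_mul]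
  congr 1
  push_cast
  ring

lemma kernel_integral {d : ℕ} {S : Matrix (Fin d) (Fin d) ℝ} (hS : S.PosDef)
    (m x : Fin d → ℝ) (σ : ℝ) (hσ : 0 < σ) :
    ∫ y, gaussKernel σ x y ∂(gaussianMeasure m S) =
      ((1 : Matrix (Fin d) (Fin d) ℝ) + (2 * σ) • S).det ^ (-(1:ℝ)/2) *
      Real.exp (-σ * ((x - m) ⬝ᵥ (((1 : Matrix (Fin d) (Fin d) ℝ) + (2 * σ) • S)⁻¹ *ᵥ (x - m)))) := by
  simp_rw [kernel_eq]
  rw [key_integral hS PosDef.one m x σ hσ]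
  simp

lemma rpow_half_cancel {x : ℝ} (hx : 0 < x) : x ^ (-(1:ℝ)/2) * x ^ ((1:ℝ)/2) = 1 := by
  rw [← Real.rpow_add hx]; norm_num

lemma rpow_half_sq {x : ℝ} (hx : 0 < x) : (x ^ (-(1:ℝ)/2)) ^ 2 = x⁻¹ := by
  rw [← Real.rpow_natCast, ← Real.rpow_mul hx.le]; norm_num; rw [Real.rpow_neg_one]

lemma kk_integral {d : ℕ} {S₁ S₂ : Matrix (Fin d) (Fin d) ℝ} (h₁ : S₁.PosDef) (h₂ : S₂.PosDef)
    (m₁ m₂ : Fin d → ℝ) (σ : ℝ) (hσ : 0 < σ) :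
    ∫ x, ∫ y, gaussKernel σ x y ∂(gaussianMeasure m₂ S₂) ∂(gaussianMeasure m₁ S₁) =
      ((1 : Matrix (Fin d) (Fin d) ℝ) + (2 * σ) • S₂ + (2 * σ) • S₁).det ^ (-(1:ℝ)/2) *
      Real.exp (-σ * ((m₂ - m₁) ⬝ᵥ
        (((1 : Matrix (Fin d) (Fin d) ℝ) + (2 * σ) • S₂ + (2 * σ) • S₁)⁻¹ *ᵥ (m₂ - m₁)))) := by
  have hA : ((1 : Matrix (Fin d) (Fin d) ℝ) + (2 * σ) • S₂).PosDef :=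
    PosDef.one.add (h₂.smul (by positivity))
  simp_rw [kernel_integral h₂ m₂ _ σ hσ]
  rw [integral_const_mul, key_integral h₁ hA m₁ m₂ σ hσ, ← mul_assoc, ← mul_assoc,
    rpow_half_cancel hA.det_pos, one_mul]

lemma sq_integral {d : ℕ} {S₁ S₂ : Matrix (Fin d) (Fin d) ℝ} (h₁ : S₁.PosDef) (h₂ : S₂.PosDef)
    (m₁ m₂ : Fin d → ℝ) (σ : ℝ) (hσ : 0 < σ) :
    ∫ x, (∫ y, gaussKernel σ x y ∂(gaussianMeasure m₂ S₂)) ^ 2 ∂(gaussianMeasure m₁ S₁) =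
      ((1 : Matrix (Fin d) (Fin d) ℝ) + (2 * σ) • S₂).det ^ (-(1:ℝ)/2) *
      ((1 : Matrix (Fin d) (Fin d) ℝ) + (2 * σ) • S₂ + (4 * σ) • S₁).det ^ (-(1:ℝ)/2) *
      Real.exp (-(2 * σ) * ((m₂ - m₁) ⬝ᵥ
        (((1 : Matrix (Fin d) (Fin d) ℝ) + (2 * σ) • S₂ + (4 * σ) • S₁)⁻¹ *ᵥ (m₂ - m₁)))) := by
  have hA : ((1 : Matrix (Fin d) (Fin d) ℝ) + (2 * σ) • S₂).PosDef :=
    PosDef.one.add (h₂.smul (by positivity))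
  simp_rw [kernel_integral h₂ m₂ _ σ hσ, mul_pow, ← Real.exp_nat_mul]
  have : ∀ q : ℝ, ((2:ℕ):ℝ) * (-σ * q) = -(2 * σ) * q := by intro q; push_cast; ring
  simp_rw [this]
  rw [integral_const_mul, key_integral h₁ hA m₁ m₂ (2 * σ) (by positivity), ← mul_assoc,
    ← mul_assoc, show 2 * (2 * σ) = 4 * σ by ring, pow_two, mul_assoc (_ ^ (-(1:ℝ)/2)) _ (_ ^ ((1:ℝ)/2)),
    rpow_half_cancel hA.det_pos, mul_one]

lemma Jk_gauss {d : ℕ} {S₁ S₂ : Matrix (Fin d) (Fin d) ℝ} (h₁ : S₁.PosDef) (h₂ : S₂.PosDef)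
    (m₁ m₂ : Fin d → ℝ) (σ : ℝ) (hσ : 0 < σ) :
    Jk (gaussKernel σ) (gaussianMeasure m₁ S₁) (gaussianMeasure m₂ S₂) =
      ((1 : Matrix (Fin d) (Fin d) ℝ) + (4 * σ) • S₂ + (4 * σ) • S₁).det ^ (-(1:ℝ)/2) *
      Real.exp (-(2 * σ) * ((m₂ - m₁) ⬝ᵥ
        (((1 : Matrix (Fin d) (Fin d) ℝ) + (4 * σ) • S₂ + (4 * σ) • S₁)⁻¹ *ᵥ (m₂ - m₁))))
      - ((1 : Matrix (Fin d) (Fin d) ℝ) + (2 * σ) • S₂).det ^ (-(1:ℝ)/2) *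
      ((1 : Matrix (Fin d) (Fin d) ℝ) + (2 * σ) • S₂ + (4 * σ) • S₁).det ^ (-(1:ℝ)/2) *
      Real.exp (-(2 * σ) * ((m₂ - m₁) ⬝ᵥ
        (((1 : Matrix (Fin d) (Fin d) ℝ) + (2 * σ) • S₂ + (4 * σ) • S₁)⁻¹ *ᵥ (m₂ - m₁))))
      - ((1 : Matrix (Fin d) (Fin d) ℝ) + (2 * σ) • S₁).det ^ (-(1:ℝ)/2) *
      ((1 : Matrix (Fin d) (Fin d) ℝ) + (2 * σ) • S₁ + (4 * σ) • S₂).det ^ (-(1:ℝ)/2) *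
      Real.exp (-(2 * σ) * ((m₁ - m₂) ⬝ᵥ
        (((1 : Matrix (Fin d) (Fin d) ℝ) + (2 * σ) • S₁ + (4 * σ) • S₂)⁻¹ *ᵥ (m₁ - m₂))))
      + ((1 : Matrix (Fin d) (Fin d) ℝ) + (2 * σ) • S₂ + (2 * σ) • S₁).det⁻¹ *
      Real.exp (-(2 * σ) * ((m₂ - m₁) ⬝ᵥ
        (((1 : Matrix (Fin d) (Fin d) ℝ) + (2 * σ) • S₂ + (2 * σ) • S₁)⁻¹ *ᵥ (m₂ - m₁)))) := by
  have hT : ((1 : Matrix (Fin d) (Fin d) ℝ) + (2 * σ) • S₂ + (2 * σ) • S₁).PosDef :=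
    (PosDef.one.add (h₂.smul (by positivity))).add (h₁.smul (by positivity))
  have hsw : (∫ y, (∫ x, gaussKernel σ x y ∂(gaussianMeasure m₁ S₁)) ^ 2 ∂(gaussianMeasure m₂ S₂))
      = ∫ y, (∫ x, gaussKernel σ y x ∂(gaussianMeasure m₁ S₁)) ^ 2 ∂(gaussianMeasure m₂ S₂) := by
    simp_rw [fun x y => kernel_symm σ x y]
  rw [Jk, hsw, sq_integral h₁ h₂ m₁ m₂ σ hσ, sq_integral h₂ h₁ m₂ m₁ σ hσ,
    kk_integral h₁ h₂ m₁ m₂ σ hσ]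
  simp_rw [kernel_sq]
  rw [kk_integral h₁ h₂ m₁ m₂ (2 * σ) (by positivity), mul_pow, rpow_half_sq hT.det_pos,
    ← Real.exp_nat_mul, show 2 * (2 * σ) = 4 * σ by ring]
  congr 3
  push_cast
  ring

theorem stmt1 (d : ℕ) (hd : 1 ≤ d) (σ : ℝ) (hσ : 0 < σ) (m : Fin d → ℝ)
    (S : Matrix (Fin d) (Fin d) ℝ) (hSsym : S.IsSymm) (hSpd : S.PosDef) :
    mvdSq (gaussKernel σ) (gaussianMeasure 0 1) (gaussianMeasure m S) =
      (1 + 8 * σ) ^ (-(d : ℝ) / 2) - 2 * (1 + 8 * σ + 12 * σ ^ 2) ^ (-(d : ℝ) / 2)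
        + (1 + 4 * σ) ^ (-(d : ℝ))
      + ((1 : Matrix (Fin d) (Fin d) ℝ) + (8 * σ) • S).det ^ (-(1 : ℝ) / 2)
      - 2 * ((1 : Matrix (Fin d) (Fin d) ℝ) + (8 * σ) • S + (12 * σ ^ 2) • (S * S)).det
          ^ (-(1 : ℝ) / 2)
      + (((1 : Matrix (Fin d) (Fin d) ℝ) + (4 * σ) • S).det)⁻¹
      - 2 * ((1 + 4 * σ) • (1 : Matrix (Fin d) (Fin d) ℝ) + (4 * σ) • S).det ^ (-(1 : ℝ) / 2)
          * Real.exp (-(2 * σ) *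
              (m ⬝ᵥ (((1 + 4 * σ) • (1 : Matrix (Fin d) (Fin d) ℝ) + (4 * σ) • S)⁻¹ *ᵥ m)))
      + 2 * ((1 : Matrix (Fin d) (Fin d) ℝ) + (2 * σ) • S).det ^ (-(1 : ℝ) / 2)
          * ((1 + 4 * σ) • (1 : Matrix (Fin d) (Fin d) ℝ) + (2 * σ) • S).det ^ (-(1 : ℝ) / 2)
          * Real.exp (-(2 * σ) *
              (m ⬝ᵥ (((1 + 4 * σ) • (1 : Matrix (Fin d) (Fin d) ℝ) + (2 * σ) • S)⁻¹ *ᵥ m)))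
      + 2 * (1 + 2 * σ) ^ (-(d : ℝ) / 2)
          * ((1 + 2 * σ) • (1 : Matrix (Fin d) (Fin d) ℝ) + (4 * σ) • S).det ^ (-(1 : ℝ) / 2)
          * Real.exp (-(2 * σ) *
              (m ⬝ᵥ (((1 + 2 * σ) • (1 : Matrix (Fin d) (Fin d) ℝ) + (4 * σ) • S)⁻¹ *ᵥ m)))
      - 2 * (((1 + 2 * σ) • (1 : Matrix (Fin d) (Fin d) ℝ) + (2 * σ) • S).det)⁻¹
          * Real.exp (-(2 * σ) *
              (m ⬝ᵥ (((1 + 2 * σ) • (1 : Matrix (Fin d) (Fin d) ℝ) + (2 * σ) • S)⁻¹ *ᵥ m))) := by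
  rw [mvdSq, Jk_gauss PosDef.one PosDef.one 0 0 σ hσ, Jk_gauss hSpd hSpd m m σ hσ,
    Jk_gauss PosDef.one hSpd 0 m σ hσ]
  have smd : ∀ r : ℝ, (r • (1 : Matrix (Fin d) (Fin d) ℝ)).det = r ^ d := by
    intro r; simp [det_smul]
  have hpow : ∀ r : ℝ, 0 < r → (r ^ d) ^ (-(1:ℝ)/2) = r ^ (-(d:ℝ)/2) := by
    intro r hr
    rw [← Real.rpow_natCast, ← Real.rpow_mul hr.le]
    congr 1; ring
  have hinv : ∀ r : ℝ, 0 < r → (r ^ d)⁻¹ = r ^ (-(d:ℝ)) := by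
    intro r hr
    rw [Real.rpow_neg hr.le, Real.rpow_natCast]
  have a1 : (1 : Matrix (Fin d) (Fin d) ℝ) + (4 * σ) • 1 + (4 * σ) • 1 = (1 + 8 * σ) • 1 := by
    module
  have a2 : (1 : Matrix (Fin d) (Fin d) ℝ) + (2 * σ) • 1 + (4 * σ) • 1 = (1 + 6 * σ) • 1 := by
    module
  have a3 : (1 : Matrix (Fin d) (Fin d) ℝ) + (2 * σ) • 1 + (2 * σ) • 1 = (1 + 4 * σ) • 1 := by
    module
  have a4 : (1 : Matrix (Fin d) (Fin d) ℝ) + (2 * σ) • 1 = (1 + 2 * σ) • 1 := by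
    module
  have b1 : (1 : Matrix (Fin d) (Fin d) ℝ) + (4 * σ) • S + (4 * σ) • S = 1 + (8 * σ) • S := by
    module
  have b2 : (1 : Matrix (Fin d) (Fin d) ℝ) + (2 * σ) • S + (4 * σ) • S = 1 + (6 * σ) • S := by
    module
  have b3 : (1 : Matrix (Fin d) (Fin d) ℝ) + (2 * σ) • S + (2 * σ) • S = 1 + (4 * σ) • S := by
    module
  have c1 : (1 : Matrix (Fin d) (Fin d) ℝ) + (4 * σ) • S + (4 * σ) • 1
      = (1 + 4 * σ) • 1 + (4 * σ) • S := by module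
  have c2 : (1 : Matrix (Fin d) (Fin d) ℝ) + (2 * σ) • S + (4 * σ) • 1
      = (1 + 4 * σ) • 1 + (2 * σ) • S := by module
  have c4 : (1 : Matrix (Fin d) (Fin d) ℝ) + (2 * σ) • S + (2 * σ) • 1
      = (1 + 2 * σ) • 1 + (2 * σ) • S := by module
  have p1 : (1 + 8 * σ + 12 * σ ^ 2) ^ (-(d : ℝ) / 2)
      = (1 + 2 * σ) ^ (-(d : ℝ) / 2) * (1 + 6 * σ) ^ (-(d : ℝ) / 2) := by
    rw [← Real.mul_rpow (by positivity) (by positivity)]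
    congr 1; ring
  have h2 : ((1 : Matrix (Fin d) (Fin d) ℝ) + (2 * σ) • S).PosDef :=
    PosDef.one.add (hSpd.smul (by positivity))
  have h6 : ((1 : Matrix (Fin d) (Fin d) ℝ) + (6 * σ) • S).PosDef :=
    PosDef.one.add (hSpd.smul (by positivity))
  have p2 : ((1 : Matrix (Fin d) (Fin d) ℝ) + (8 * σ) • S + (12 * σ ^ 2) • (S * S)).det
          ^ (-(1 : ℝ) / 2) = ((1 : Matrix (Fin d) (Fin d) ℝ) + (2 * σ) • S).det ^ (-(1 : ℝ) / 2)
          * ((1 : Matrix (Fin d) (Fin d) ℝ) + (6 * σ) • S).det ^ (-(1 : ℝ) / 2) := by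
    rw [← Real.mul_rpow h2.det_pos.le h6.det_pos.le, ← det_mul]
    congr 2
    simp only [mul_add, add_mul, Matrix.mul_smul, Matrix.smul_mul, mul_one, one_mul]
    module
  rw [a1, a2, a3, b1, b2, b3, c1, c2, c4, a4, p1, p2]
  simp only [smd, sub_self, sub_zero, zero_sub, neg_dotProduct, mulVec_neg, dotProduct_neg, neg_neg,
    zero_dotProduct, mul_zero, Real.exp_zero, mul_one]
  rw [hpow _ (by positivity), hpow _ (by positivity), hpow _ (by positivity),
    hinv _ (by positivity)]
  ring
end

section
/- Let d ≥ 1, σ > 0, t ∈ ℝ, s > 0, and let 1 denote the all-ones vector in ℝ^d. For the Gaussian kernel k_σ on ℝ^d, MMD_{k_σ}(N(0,I_d), N(t·1, s·I_d))² = (1+4σ)^{-d/2} + (1+4σs)^{-d/2} − 2(1+2σ+2σs)^{-d/2}·exp(−σt²d/(1+2σ+2σs)). -/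
open MeasureTheory Matrix

theorem aux1 (b v x m : ℝ) (hb : 0 < b) (hv : 0 < v) :
    ∫ y : ℝ, ((2 * Real.pi * v) ^ (-(1 : ℝ) / 2) * Real.exp (-(1 / 2) * (v⁻¹ * (y - m) ^ 2))) *
      Real.exp (-b * (x - y) ^ 2) =
    (1 + 2 * b * v) ^ (-(1 : ℝ) / 2) * Real.exp (-(b / (1 + 2 * b * v)) * (x - m) ^ 2) := by
  have hD : 0 < 1 + 2 * b * v := by positivity
  have h1 : ∀ y : ℝ, ((2 * Real.pi * v) ^ (-(1 : ℝ) / 2) *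
      Real.exp (-(1 / 2) * (v⁻¹ * (y - m) ^ 2))) * Real.exp (-b * (x - y) ^ 2) =
      ((2 * Real.pi * v) ^ (-(1 : ℝ) / 2) *
        Real.exp (-(b / (1 + 2 * b * v)) * (x - m) ^ 2)) *
      Real.exp (-((1 + 2 * b * v) / (2 * v)) *
        (y - (2 * b * v * x + m) / (1 + 2 * b * v)) ^ 2) := by
    intro y
    rw [mul_assoc (_ ^ _) (Real.exp _) (Real.exp _), mul_assoc (_ ^ _) (Real.exp _) (Real.exp _),
      ← Real.exp_add, ← Real.exp_add]
    congr 2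
    field_simp
    ring
  simp_rw [h1]
  rw [integral_const_mul, integral_sub_right_eq_self
    (fun y : ℝ => Real.exp (-((1 + 2 * b * v) / (2 * v)) * y ^ 2)), integral_gaussian]
  have h2 : Real.pi / ((1 + 2 * b * v) / (2 * v)) = (2 * Real.pi * v) / (1 + 2 * b * v) := by
    field_simp
  have hp : 0 < 2 * Real.pi * v := by positivity
  rw [h2, Real.sqrt_eq_rpow, Real.div_rpow hp.le hD.le, neg_div, Real.rpow_neg hp.le,
    Real.rpow_neg hD.le]
  have := Real.rpow_pos_of_pos hp (1 / 2)
  have := Real.rpow_pos_of_pos hD (1 / 2)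
  field_simp

theorem aux_pow (d : ℕ) (a : ℝ) (ha : 0 < a) :
    (a ^ (-(1 : ℝ) / 2)) ^ d = a ^ (-(d : ℝ) / 2) := by
  rw [← Real.rpow_natCast, ← Real.rpow_mul ha.le]
  congr 1
  ring

theorem aux2 (d : ℕ) (b v : ℝ) (x m : Fin d → ℝ) (hb : 0 < b) (hv : 0 < v) :
    ∫ y, gaussKernel b x y ∂(gaussianMeasure m (v • 1)) =
      (1 + 2 * b * v) ^ (-(d : ℝ) / 2) * gaussKernel (b / (1 + 2 * b * v)) x m := by
  have hp : 0 < 2 * Real.pi * v := by positivity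
  have hinv : (v • (1 : Matrix (Fin d) (Fin d) ℝ))⁻¹ = v⁻¹ • 1 := by
    apply Matrix.inv_eq_right_inv
    simp [hv.ne']
  unfold gaussianMeasure
  rw [hinv, integral_withDensity_eq_integral_toReal_smul (by
      apply Measurable.ennreal_ofReal
      simp only [dotProduct, Matrix.smul_mulVec, Matrix.one_mulVec]
      fun_prop) (by simp)]
  have hdet : (2 * Real.pi) ^ d * (v • (1 : Matrix (Fin d) (Fin d) ℝ)).det
      = (2 * Real.pi * v) ^ d := by
    simp [Matrix.det_smul, mul_pow]
  have h1 : ∀ y : Fin d → ℝ, (ENNReal.ofReal (((2 * Real.pi) ^ d *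
      (v • (1 : Matrix (Fin d) (Fin d) ℝ)).det) ^ (-(1 : ℝ) / 2) *
      Real.exp (-(1 / 2) * ((y - m) ⬝ᵥ ((v⁻¹ • (1 : Matrix (Fin d) (Fin d) ℝ)) *ᵥ (y - m)))))).toReal
      • gaussKernel b x y = ∏ i, (((2 * Real.pi * v) ^ (-(1 : ℝ) / 2) *
        Real.exp (-(1 / 2) * (v⁻¹ * (y i - m i) ^ 2))) * Real.exp (-b * (x i - y i) ^ 2)) := by
    intro y
    rw [hdet, ENNReal.toReal_ofReal (by positivity), smul_eq_mul, Finset.prod_mul_distrib,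
      Finset.prod_mul_distrib, ← Real.exp_sum, ← Real.exp_sum, Finset.prod_const,
      Finset.card_univ, Fintype.card_fin, aux_pow d _ hp, gaussKernel, Finset.mul_sum,
      ← Real.rpow_natCast, ← Real.rpow_mul hp.le, Matrix.smul_mulVec, Matrix.one_mulVec,
      dotProduct, Finset.mul_sum]
    have he : (d : ℝ) * (-1 / 2) = -(d : ℝ) / 2 := by ring
    rw [he]
    congr 3
    · apply Finset.sum_congr rfl
      intro i _
      simp
      ring
  simp_rw [h1]
  rw [integral_fintype_prod_volume_eq_prod (fun i (z : ℝ) =>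
    (((2 * Real.pi * v) ^ (-(1 : ℝ) / 2) *
        Real.exp (-(1 / 2) * (v⁻¹ * (z - m i) ^ 2))) * Real.exp (-b * (x i - z) ^ 2)))]
  simp_rw [aux1 b v _ _ hb hv]
  rw [Finset.prod_mul_distrib, ← Real.exp_sum, Finset.prod_const,
      Finset.card_univ, Fintype.card_fin, aux_pow d _ (by positivity), gaussKernel, Finset.mul_sum]

theorem aux3 (d : ℕ) (b u v : ℝ) (l m : Fin d → ℝ) (hb : 0 < b) (hu : 0 < u) (hv : 0 < v) :
    ∫ x, ∫ y, gaussKernel b x y ∂(gaussianMeasure m (v • 1)) ∂(gaussianMeasure l (u • 1)) =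
      (1 + 2 * b * v + 2 * b * u) ^ (-(d : ℝ) / 2) *
        gaussKernel (b / (1 + 2 * b * v + 2 * b * u)) m l := by
  have hD : 0 < 1 + 2 * b * v := by positivity
  have hs : ∀ (c : ℝ) (x : Fin d → ℝ), gaussKernel c x m = gaussKernel c m x := by
    intro c x
    simp only [gaussKernel]
    congr 2
    apply Finset.sum_congr rfl
    intro i _
    ring
  simp_rw [aux2 d b v _ m hb hv, integral_const_mul, hs]
  rw [aux2 d _ u m l (by positivity) hu, ← mul_assoc, ← Real.mul_rpow hD.le (by positivity)]
  congr 2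
  · field_simp
  · field_simp

theorem stmt2 (d : ℕ) (hd : 1 ≤ d) (σ : ℝ) (hσ : 0 < σ) (t : ℝ) (s : ℝ) (hs : 0 < s) :
    mmdSq (gaussKernel σ) (gaussianMeasure (0 : Fin d → ℝ) 1)
        (gaussianMeasure (fun _ => t) (s • 1)) =
      (1 + 4 * σ) ^ (-(d : ℝ) / 2) + (1 + 4 * σ * s) ^ (-(d : ℝ) / 2)
        - 2 * (1 + 2 * σ + 2 * σ * s) ^ (-(d : ℝ) / 2)
          * Real.exp (-(σ * t ^ 2 * (d : ℝ)) / (1 + 2 * σ + 2 * σ * s)) := by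
  have e : gaussianMeasure (0 : Fin d → ℝ) 1 = gaussianMeasure (0 : Fin d → ℝ) ((1 : ℝ) • 1) := by
    rw [one_smul]
  unfold mmdSq
  rw [e, aux3 d σ 1 1 _ _ hσ one_pos one_pos, aux3 d σ s s _ _ hσ hs hs,
    aux3 d σ 1 s _ _ hσ one_pos hs]
  have e1 : 1 + 2 * σ * 1 + 2 * σ * 1 = 1 + 4 * σ := by ring
  have e2 : 1 + 2 * σ * s + 2 * σ * s = 1 + 4 * σ * s := by ring
  have e3 : 1 + 2 * σ * s + 2 * σ * 1 = 1 + 2 * σ + 2 * σ * s := by ring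
  rw [e1, e2, e3]
  simp only [gaussKernel, sub_self, Pi.zero_apply, sub_zero, Finset.sum_const, Finset.card_univ,
    Fintype.card_fin, nsmul_eq_mul]
  have e4 : -(σ / (1 + 2 * σ + 2 * σ * s)) * ((d : ℝ) * t ^ 2) =
      -(σ * t ^ 2 * (d : ℝ)) / (1 + 2 * σ + 2 * σ * s) := by ring
  rw [e4]
  simp
  ring
end

section
/- Let d ≥ 1, σ > 0, t ∈ ℝ, s > 0, and let 1 denote the all-ones vector in ℝ^d. For the Gaussian kernel k_σ on ℝ^d, MVD_{k_σ}(N(0,I_d), N(t·1, s·I_d))² = (1+8σ)^{-d/2} − 2(1+8σ+12σ²)^{-d/2} + (1+4σ)^{-d} + (1+8σs)^{-d/2} − 2(1+8σs+12σ²s²)^{-d/2} + (1+4σs)^{-d} − 2(1+4σ+4σs)^{-d/2}·exp(−2σt²d/(1+4σ+4σs)) + 2(1+2σs)^{-d/2}(1+4σ+2σs)^{-d/2}·exp(−2σt²d/(1+4σ+2σs)) + 2(1+2σ)^{-d/2}(1+2σ+4σs)^{-d/2}·exp(−2σt²d/(1+2σ+4σs)) − 2(1+2σ+2σs)^{-d}·exp(−2σt²d/(1+2σ+2σs)).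 -/
open MeasureTheory Matrix

lemma one_dim (a v m x : ℝ) (ha : 0 < a) (hv : 0 < v) :
    ∫ y : ℝ, (2 * Real.pi * v) ^ (-(1:ℝ) / 2) * Real.exp (-(1/2) * ((y - m) * (v⁻¹ * (y - m))))
        * Real.exp (-a * (y - x) ^ 2)
      = (1 + 2 * a * v) ^ (-(1:ℝ) / 2) * Real.exp (-(a / (1 + 2 * a * v)) * (x - m) ^ 2) := by
  have hw : 0 < 1 + 2 * a * v := by positivity
  have hpi := Real.pi_pos
  have h1 : ∀ y : ℝ, (2 * Real.pi * v) ^ (-(1:ℝ) / 2)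
        * Real.exp (-(1/2) * ((y - m) * (v⁻¹ * (y - m)))) * Real.exp (-a * (y - x) ^ 2)
      = ((2 * Real.pi * v) ^ (-(1:ℝ) / 2) * Real.exp (-(a / (1 + 2 * a * v)) * (x - m) ^ 2))
        * Real.exp (-((1 + 2 * a * v) / (2 * v)) * (y - (m + 2 * a * v * x) / (1 + 2 * a * v)) ^ 2) := by
    intro y
    rw [mul_assoc (_ ^ _), mul_assoc (_ ^ _), ← Real.exp_add, ← Real.exp_add]
    congr 2
    field_simp
    ring
  simp_rw [h1]
  rw [integral_const_mul,
    integral_sub_right_eq_self (fun y : ℝ => Real.exp (-((1 + 2 * a * v) / (2 * v)) * y ^ 2)),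
    integral_gaussian]
  have h2 : Real.pi / ((1 + 2 * a * v) / (2 * v)) = (2 * Real.pi * v) * (1 + 2 * a * v)⁻¹ := by
    field_simp
  have h3 : (2 * Real.pi * v) ^ (-(1:ℝ) / 2) * √(Real.pi / ((1 + 2 * a * v) / (2 * v)))
      = (1 + 2 * a * v) ^ (-(1:ℝ) / 2) := by
    have h0 : 0 < 2 * Real.pi * v := by positivity
    rw [h2, Real.sqrt_eq_rpow, Real.mul_rpow h0.le (by positivity), ← mul_assoc,
      ← Real.rpow_add h0, Real.inv_rpow hw.le, ← Real.rpow_neg hw.le]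
    norm_num
  rw [← h3]; ring

lemma key {d : ℕ} (a v m : ℝ) (ha : 0 < a) (hv : 0 < v) (x : Fin d → ℝ) :
    ∫ y, Real.exp (-a * ∑ i, (y i - x i) ^ 2) ∂(gaussianMeasure (fun _ : Fin d => m) (v • 1))
      = (1 + 2 * a * v) ^ (-(d:ℝ) / 2)
        * Real.exp (-(a / (1 + 2 * a * v)) * ∑ i, (x i - m) ^ 2) := by
  have hw : 0 < 1 + 2 * a * v := by positivity
  have hpi := Real.pi_pos
  unfold gaussianMeasure
  rw [integral_withDensity_eq_integral_toReal_smul₀]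
  rotate_left
  · refine Measurable.aemeasurable ?_
    apply ENNReal.measurable_ofReal.comp
    apply Continuous.measurable
    unfold Matrix.mulVec
    unfold dotProduct
    fun_prop
  · exact Filter.Eventually.of_forall fun _ => ENNReal.ofReal_lt_top
  have hinv : (v • (1 : Matrix (Fin d) (Fin d) ℝ))⁻¹ = v⁻¹ • 1 := by
    apply Matrix.inv_eq_right_inv
    simp [smul_smul, hv.ne']
  have h0 : 0 < 2 * Real.pi * v := by positivity
  have hdet : ((2 * Real.pi) ^ d * (v • (1 : Matrix (Fin d) (Fin d) ℝ)).det) ^ (-(1:ℝ)/2)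
      = ((2 * Real.pi * v) ^ (-(1:ℝ)/2)) ^ d := by
    rw [Matrix.det_smul, Matrix.det_one, mul_one, Fintype.card_fin, ← mul_pow,
      ← Real.rpow_natCast, ← Real.rpow_natCast, ← Real.rpow_mul h0.le, ← Real.rpow_mul h0.le,
      mul_comm (d : ℝ)]
  have h1 : ∀ y : Fin d → ℝ, (ENNReal.ofReal (((2 * Real.pi) ^ d
        * (v • (1 : Matrix (Fin d) (Fin d) ℝ)).det) ^ (-(1 : ℝ) / 2) *
      Real.exp (-(1 / 2) * ((y - fun _ => m) ⬝ᵥ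
        ((v • (1 : Matrix (Fin d) (Fin d) ℝ))⁻¹ *ᵥ (y - fun _ => m)))))).toReal
        • Real.exp (-a * ∑ i, (y i - x i) ^ 2)
      = ∏ i, (2 * Real.pi * v) ^ (-(1:ℝ) / 2)
        * Real.exp (-(1/2) * ((y i - m) * (v⁻¹ * (y i - m)))) * Real.exp (-a * (y i - x i) ^ 2) := by
    intro y
    rw [hdet, hinv, ENNReal.toReal_ofReal (by positivity), Finset.prod_mul_distrib,
      Finset.prod_mul_distrib, ← Real.exp_sum, ← Real.exp_sum, ← Finset.mul_sum, ← Finset.mul_sum]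
    simp [dotProduct, Matrix.smul_mulVec]
  simp_rw [h1]
  rw [integral_fintype_prod_volume_eq_prod (𝕜 := ℝ) (fun i (z : ℝ) => (2 * Real.pi * v) ^ (-(1:ℝ) / 2)
        * Real.exp (-(1/2) * ((z - m) * (v⁻¹ * (z - m)))) * Real.exp (-a * (z - x i) ^ 2))]
  simp_rw [one_dim a v m _ ha hv]
  rw [Finset.prod_mul_distrib, ← Real.exp_sum, ← Finset.mul_sum]
  congr 1
  rw [Finset.prod_const, Finset.card_univ, Fintype.card_fin, ← Real.rpow_natCast,
    ← Real.rpow_mul hw.le]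
  congr 1; ring

lemma key' {d : ℕ} (a v m : ℝ) (ha : 0 < a) (hv : 0 < v) (x : Fin d → ℝ) :
    ∫ y, Real.exp (-a * ∑ i, (x i - y i) ^ 2) ∂(gaussianMeasure (fun _ : Fin d => m) (v • 1))
      = (1 + 2 * a * v) ^ (-(d:ℝ) / 2)
        * Real.exp (-(a / (1 + 2 * a * v)) * ∑ i, (x i - m) ^ 2) := by
  rw [← key a v m ha hv x]
  simp_rw [fun y : Fin d → ℝ => fun i => show (x i - y i)^2 = (y i - x i)^2 by ring]

/-- double integral -/
lemma dbl {d : ℕ} (a v w m n : ℝ) (ha : 0 < a) (hv : 0 < v) (hw : 0 < w) :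
    ∫ x, ∫ y, Real.exp (-a * ∑ i, (x i - y i) ^ 2) ∂(gaussianMeasure (fun _ : Fin d => n) (w • 1))
      ∂(gaussianMeasure (fun _ : Fin d => m) (v • 1))
      = (1 + 2 * a * v + 2 * a * w) ^ (-(d:ℝ) / 2)
        * Real.exp (-(a * (m - n) ^ 2 * d) / (1 + 2 * a * v + 2 * a * w)) := by
  have h1 : 0 < 1 + 2 * a * w := by positivity
  simp_rw [key' a w n ha hw]
  rw [integral_const_mul, key _ v m (by positivity) hv (fun _ => n), ← mul_assoc,
    ← Real.mul_rpow h1.le (by positivity)]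
  congr 2
  · field_simp; ring
  · simp only [Finset.sum_const, Finset.card_univ, Fintype.card_fin, nsmul_eq_mul]
    field_simp; ring_nf

lemma sqq {d : ℕ} (a v w m n : ℝ) (ha : 0 < a) (hv : 0 < v) (hw : 0 < w) :
    ∫ x, (∫ y, Real.exp (-a * ∑ i, (x i - y i) ^ 2) ∂(gaussianMeasure (fun _ : Fin d => n) (w • 1))) ^ 2
      ∂(gaussianMeasure (fun _ : Fin d => m) (v • 1))
      = (1 + 2 * a * w) ^ (-(d:ℝ) / 2) * (1 + 4 * a * v + 2 * a * w) ^ (-(d:ℝ) / 2)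
        * Real.exp (-(2 * a * (m - n) ^ 2 * d) / (1 + 4 * a * v + 2 * a * w)) := by
  have h1 : 0 < 1 + 2 * a * w := by positivity
  have h2 : ∀ x : Fin d → ℝ, (∫ y, Real.exp (-a * ∑ i, (x i - y i) ^ 2)
      ∂(gaussianMeasure (fun _ : Fin d => n) (w • 1))) ^ 2
      = ((1 + 2 * a * w) ^ (-(d:ℝ) / 2)) ^ 2
        * Real.exp (-(2 * a / (1 + 2 * a * w)) * ∑ i, (x i - n) ^ 2) := by
    intro x
    rw [key' a w n ha hw, mul_pow, ← Real.exp_nat_mul]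
    congr 2
    push_cast; ring
  simp_rw [h2]
  rw [integral_const_mul, key _ v m (by positivity) hv (fun _ => n), ← mul_assoc, sq, mul_assoc ((1 + 2 * a * w) ^ (-(d:ℝ) / 2)),
    ← Real.mul_rpow h1.le (by positivity)]
  congr 1
  · congr 2
    field_simp; ring
  · congr 1
    simp only [Finset.sum_const, Finset.card_univ, Fintype.card_fin, nsmul_eq_mul]
    field_simp; ring_nf

lemma Jform {d : ℕ} (a v w m n : ℝ) (ha : 0 < a) (hv : 0 < v) (hw : 0 < w) :
    Jk (gaussKernel a) (gaussianMeasure (fun _ : Fin d => m) (v • 1))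
      (gaussianMeasure (fun _ : Fin d => n) (w • 1))
    = (1 + 4 * a * v + 4 * a * w) ^ (-(d:ℝ) / 2)
        * Real.exp (-(2 * a * (m - n) ^ 2 * d) / (1 + 4 * a * v + 4 * a * w))
      - (1 + 2 * a * w) ^ (-(d:ℝ) / 2) * (1 + 4 * a * v + 2 * a * w) ^ (-(d:ℝ) / 2)
        * Real.exp (-(2 * a * (m - n) ^ 2 * d) / (1 + 4 * a * v + 2 * a * w))
      - (1 + 2 * a * v) ^ (-(d:ℝ) / 2) * (1 + 2 * a * v + 4 * a * w) ^ (-(d:ℝ) / 2)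
        * Real.exp (-(2 * a * (m - n) ^ 2 * d) / (1 + 2 * a * v + 4 * a * w))
      + (1 + 2 * a * v + 2 * a * w) ^ (-(d:ℝ))
        * Real.exp (-(2 * a * (m - n) ^ 2 * d) / (1 + 2 * a * v + 2 * a * w)) := by
  unfold Jk gaussKernel
  have e1 : ∀ x y : Fin d → ℝ, Real.exp (-a * ∑ i, (x i - y i) ^ 2) ^ 2
      = Real.exp (-(2 * a) * ∑ i, (x i - y i) ^ 2) := by
    intro x y
    rw [← Real.exp_nat_mul]; congr 1; push_cast; ring
  have e2 : ∀ x y : Fin d → ℝ, ∑ i, (x i - y i) ^ 2 = ∑ i, (y i - x i) ^ 2 := by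
    intro x y
    refine Finset.sum_congr rfl fun i _ => by ring
  have e3 : ∫ y, (∫ x, Real.exp (-a * ∑ i, (x i - y i) ^ 2)
        ∂(gaussianMeasure (fun _ : Fin d => m) (v • 1))) ^ 2
        ∂(gaussianMeasure (fun _ : Fin d => n) (w • 1))
      = (1 + 2 * a * v) ^ (-(d:ℝ) / 2) * (1 + 2 * a * v + 4 * a * w) ^ (-(d:ℝ) / 2)
        * Real.exp (-(2 * a * (m - n) ^ 2 * d) / (1 + 2 * a * v + 4 * a * w)) := by
    have := sqq (d := d) a w v n m ha hw hv
    rw [show 1 + 2 * a * v + 4 * a * w = 1 + 4 * a * w + 2 * a * v by ring,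
      show (m - n) ^ 2 = (n - m) ^ 2 by ring, ← this]
    congr 1; ext y; congr 2; ext x; rw [e2]
  rw [e3, sqq a v w m n ha hv hw, dbl a v w m n ha hv hw]
  simp_rw [e1]
  have hb : 0 < 1 + 2 * a * v + 2 * a * w := by positivity
  have e4 : ((1 + 2 * a * v + 2 * a * w) ^ (-(d:ℝ) / 2)) ^ 2
      = (1 + 2 * a * v + 2 * a * w) ^ (-(d:ℝ)) := by
    rw [sq, ← Real.rpow_add hb]; congr 1; ring
  rw [dbl (2 * a) v w m n (by positivity) hv hw, mul_pow, ← Real.exp_nat_mul, e4,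
    show 2 * (2 * a) * v = 4 * a * v by ring, show 2 * (2 * a) * w = 4 * a * w by ring]
  congr 3
  push_cast; ring

theorem stmt3 (d : ℕ) (hd : 1 ≤ d) (σ : ℝ) (hσ : 0 < σ) (t : ℝ) (s : ℝ) (hs : 0 < s) :
    mvdSq (gaussKernel σ) (gaussianMeasure (0 : Fin d → ℝ) 1)
        (gaussianMeasure (fun _ => t) (s • 1)) =
      (1 + 8 * σ) ^ (-(d : ℝ) / 2) - 2 * (1 + 8 * σ + 12 * σ ^ 2) ^ (-(d : ℝ) / 2)
        + (1 + 4 * σ) ^ (-(d : ℝ))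
      + (1 + 8 * σ * s) ^ (-(d : ℝ) / 2) - 2 * (1 + 8 * σ * s + 12 * σ ^ 2 * s ^ 2) ^ (-(d : ℝ) / 2)
        + (1 + 4 * σ * s) ^ (-(d : ℝ))
      - 2 * (1 + 4 * σ + 4 * σ * s) ^ (-(d : ℝ) / 2)
          * Real.exp (-(2 * σ * t ^ 2 * (d : ℝ)) / (1 + 4 * σ + 4 * σ * s))
      + 2 * (1 + 2 * σ * s) ^ (-(d : ℝ) / 2) * (1 + 4 * σ + 2 * σ * s) ^ (-(d : ℝ) / 2)
          * Real.exp (-(2 * σ * t ^ 2 * (d : ℝ)) / (1 + 4 * σ + 2 * σ * s))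
      + 2 * (1 + 2 * σ) ^ (-(d : ℝ) / 2) * (1 + 2 * σ + 4 * σ * s) ^ (-(d : ℝ) / 2)
          * Real.exp (-(2 * σ * t ^ 2 * (d : ℝ)) / (1 + 2 * σ + 4 * σ * s))
      - 2 * (1 + 2 * σ + 2 * σ * s) ^ (-(d : ℝ))
          * Real.exp (-(2 * σ * t ^ 2 * (d : ℝ)) / (1 + 2 * σ + 2 * σ * s)) := by
  have hz : (gaussianMeasure (0 : Fin d → ℝ) 1) = gaussianMeasure (fun _ => (0:ℝ)) ((1:ℝ) • 1) := by
    rw [one_smul]; rfl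
  unfold mvdSq
  rw [hz, Jform σ 1 1 0 0 hσ one_pos one_pos, Jform σ s s t t hσ hs hs,
    Jform σ 1 s 0 t hσ one_pos hs]
  have f1 : (1 + 8 * σ + 12 * σ ^ 2) ^ (-(d : ℝ) / 2)
      = (1 + 2 * σ) ^ (-(d : ℝ) / 2) * (1 + 6 * σ) ^ (-(d : ℝ) / 2) := by
    rw [← Real.mul_rpow (by positivity) (by positivity)]; ring_nf
  have f2 : (1 + 8 * σ * s + 12 * σ ^ 2 * s ^ 2) ^ (-(d : ℝ) / 2)
      = (1 + 2 * σ * s) ^ (-(d : ℝ) / 2) * (1 + 6 * σ * s) ^ (-(d : ℝ) / 2) := by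
    rw [← Real.mul_rpow (by positivity) (by positivity)]; ring_nf
  rw [f1, f2]
  simp only [mul_one, sub_self, zero_sub, neg_sq, ne_eq, OfNat.ofNat_ne_zero, not_false_eq_true,
    zero_pow, mul_zero, zero_mul, neg_zero, zero_div, Real.exp_zero]
  rw [show 1 + 4 * σ + 4 * σ = 1 + 8 * σ by ring, show 1 + 4 * σ + 2 * σ = 1 + 6 * σ by ring,
    show 1 + 2 * σ + 4 * σ = 1 + 6 * σ by ring, show 1 + 2 * σ + 2 * σ = 1 + 4 * σ by ring,
    show 1 + 4 * σ * s + 4 * σ * s = 1 + 8 * σ * s by ring,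
    show 1 + 4 * σ * s + 2 * σ * s = 1 + 6 * σ * s by ring,
    show 1 + 2 * σ * s + 4 * σ * s = 1 + 6 * σ * s by ring,
    show 1 + 2 * σ * s + 2 * σ * s = 1 + 4 * σ * s by ring]
  ring
end

section
/- Let F be a separable real Hilbert space, let U₁, U₂, … be i.i.d. F-valued random elements with E‖U₁‖² < ∞ and mean a = E[U₁], and let W₁, W₂, … be i.i.d. F-valued random elements, independent of the U's, with E‖W₁‖² < ∞ and mean b = E[W₁]. For n, m ≥ 1 set Ūₙ = (1/n)∑_{i=1}^n U_i, W̄ₘ = (1/m)∑_{j=1}^m W_j, T̂²_{n,m} = ‖Ūₙ − W̄ₘ‖², and T² = ‖a − b‖². Then for any sequences n_j, m_j → ∞ with n_j/(n_j+m_j) → ρ ∈ (0,1), √(n_j+m_j)·(T̂²_{n_j,m_j} − T²) converges in distribution to the normal law N(0, 4ρ⁻¹·Var(⟨a−b, U₁⟩) + 4(1−ρ)⁻¹·Var(⟨a−b, W₁⟩)). (Applied with U_i = (k(·,X_i)−μ_k(P))^{⊗2} and W_j = (k(·,Y_j)−μ_k(Q))^{⊗2} in F = H(k)⊗H(k), this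 is the asymptotic non-null distribution of the MVD statistic, with variance 4ρ⁻¹v_P² + 4(1−ρ)⁻¹v_Q².) -/
open MeasureTheory ProbabilityTheory Filter

lemma secmom_aux {F : Type*} [NormedAddCommGroup F] [InnerProductSpace ℝ F] [CompleteSpace F]
    [SecondCountableTopology F] [MeasurableSpace F] [BorelSpace F]
    {Ω : Type*} [MeasurableSpace Ω] {μ : Measure Ω} [IsProbabilityMeasure μ]
    {X : ℕ → Ω → F} (hm : ∀ i, Measurable (X i)) (hi : iIndepFun X μ)
    (hid : ∀ i, IdentDistrib (X i) (X 0) μ μ) (h0 : ∫ ω, X 0 ω ∂μ = 0)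
    (h2 : MemLp (X 0) 2 μ) (n : ℕ) :
    ∫ ω, ‖∑ i ∈ Finset.range n, X i ω‖ ^ 2 ∂μ = n * ∫ ω, ‖X 0 ω‖ ^ 2 ∂μ := by
  have hL : ∀ i, MemLp (X i) 2 μ := fun i => (hid i).memLp_iff.2 h2
  have hS : ∀ n, MemLp (fun ω => ∑ i ∈ Finset.range n, X i ω) 2 μ := fun n =>
    memLp_finsetSum _ fun i _ => hL i
  induction n with
  | zero => simp
  | succ n ih =>
    have e : ∀ ω, ‖∑ i ∈ Finset.range (n+1), X i ω‖ ^ 2 =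
        ‖∑ i ∈ Finset.range n, X i ω‖ ^ 2
          + 2 * inner ℝ (∑ i ∈ Finset.range n, X i ω) (X n ω) + ‖X n ω‖ ^ 2 := by
      intro ω
      rw [Finset.sum_range_succ, norm_add_sq_real]
    have hind : IndepFun (fun ω => ∑ i ∈ Finset.range n, X i ω) (X n) μ := by
      have := hi.indepFun_sum_range_succ hm n
      convert! this using 1
      ext ω; simp
    have hin : Integrable (fun ω => inner ℝ (∑ i ∈ Finset.range n, X i ω) (X n ω)) μ :=
      by
      exact hind.integrable_bilin ((hS n).integrable one_le_two)
        ((hL n).integrable one_le_two) (innerSL ℝ)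
    have hz : ∫ ω, inner ℝ (∑ i ∈ Finset.range n, X i ω) (X n ω) ∂μ = 0 := by
      have : ∫ ω, inner ℝ (∑ i ∈ Finset.range n, X i ω) (X n ω) ∂μ =
          inner ℝ (∫ ω, ∑ i ∈ Finset.range n, X i ω ∂μ) (∫ ω, X n ω ∂μ) :=
        hind.integral_bilin ((hS n).integrable one_le_two)
        ((hL n).integrable one_le_two) (innerSL ℝ)
      rw [this, (hid n).integral_eq, h0, inner_zero_right]
    have hsq : ∫ ω, ‖X n ω‖ ^ 2 ∂μ = ∫ ω, ‖X 0 ω‖ ^ 2 ∂μ :=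
      ((hid n).comp (u := fun x : F => ‖x‖ ^ 2) (by fun_prop)).integral_eq
    simp_rw [e]
    rw [integral_add, integral_add, integral_const_mul, hz, ih, hsq]
    · push_cast; ring
    · exact (hS n).norm.integrable_sq
    · exact hin.const_mul 2
    · exact (hS n).norm.integrable_sq.add (hin.const_mul 2)
    · exact (hL n).norm.integrable_sq

lemma clt_aux {Ω : Type*} [MeasurableSpace Ω] {μ : Measure Ω} [IsProbabilityMeasure μ]
    {X : ℕ → Ω → ℝ} (hi : iIndepFun X μ)
    (hid : ∀ i, IdentDistrib (X i) (X 0) μ μ) (h2 : MemLp (X 0) 2 μ)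
    (n : ℕ → ℕ) (hn : Tendsto n atTop atTop) (c : ℕ → ℝ) (c₀ : ℝ)
    (hc : Tendsto c atTop (nhds c₀)) (t : ℝ) :
    Tendsto (fun j => charFun (μ.map (fun ω => c j * ((√(n j : ℝ))⁻¹ *
      (∑ k ∈ Finset.range (n j), X k ω - n j * ∫ ω, X 0 ω ∂μ)))) t) atTop
      (nhds (charFun (gaussianReal 0 (c₀ ^ 2 * Var[X 0; μ]).toNNReal) t)) := by
  have h := tendstoInDistribution_inv_sqrt_mul_sum_sub (P' := gaussianReal 0 Var[X 0; μ].toNNReal)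
    (Y := id) HasLaw.id h2 hi hid
  have h' : TendstoInDistribution (fun j ω => (√(n j : ℝ))⁻¹ *
      (∑ k ∈ Finset.range (n j), X k ω - n j * ∫ ω, X 0 ω ∂μ)) atTop id (fun _ => μ)
      (gaussianReal 0 Var[X 0; μ].toNNReal) :=
    ⟨fun j => h.forall_aemeasurable (n j), h.aemeasurable_limit, h.tendsto.comp hn⟩
  have hcm : TendstoInMeasure μ (fun j _ => c j) atTop (fun _ => c₀) :=
    tendstoInMeasure_of_tendsto_ae (by fun_prop) (by simpa using hc)
  have h3 := h'.continuous_comp_prodMk_of_tendstoInMeasure_const (g := fun p : ℝ × ℝ => p.2 * p.1)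
    (by fun_prop) hcm (by fun_prop)
  have h4 := ProbabilityMeasure.tendsto_iff_tendsto_charFun.1 h3.tendsto t
  simp only [ProbabilityMeasure.coe_mk] at h4
  convert h4 using 3
  simp only [id]
  rw [gaussianReal_map_const_mul]
  congr 1
  · simp
  · rw [Real.toNNReal_mul (sq_nonneg _)]
    congr 1
    ext; simp [sq_nonneg]

lemma tim_aux {Ω : Type*} [MeasurableSpace Ω] {μ : Measure Ω} [IsProbabilityMeasure μ]
    (f g : ℕ → Ω → ℝ) (hg : ∀ j, Integrable (g j) μ)
    (hfg : ∀ᶠ j in atTop, ∀ ω, |f j ω| ≤ g j ω)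
    (hlim : Tendsto (fun j => ∫ ω, g j ω ∂μ) atTop (nhds 0)) :
    TendstoInMeasure μ f atTop 0 := by
  rw [tendstoInMeasure_iff_measureReal_norm]
  intro ε hε
  have h1 : Tendsto (fun j => ε⁻¹ * ∫ ω, g j ω ∂μ) atTop (nhds 0) := by
    simpa using hlim.const_mul ε⁻¹
  refine squeeze_zero' (Eventually.of_forall fun _ => measureReal_nonneg) ?_ h1
  filter_upwards [hfg] with j hj
  have h2 := mul_meas_ge_le_integral_of_nonneg
    (ae_of_all μ fun ω => (abs_nonneg _).trans (hj ω)) (hg j) ε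
  have h3 : μ.real {x | ε ≤ ‖f j x - (0 : Ω → ℝ) x‖} ≤ μ.real {x | ε ≤ g j x} := by
    refine measureReal_mono fun x hx => ?_
    simp only [Set.mem_ofPred_eq, Pi.zero_apply, sub_zero, Real.norm_eq_abs] at hx ⊢
    exact hx.trans (hj x)
  rw [le_inv_mul_iff₀ hε]
  exact (mul_le_mul_of_nonneg_left h3 hε.le).trans h2

lemma indep_aux {F : Type*} [MeasurableSpace F]
    {Ω : Type*} [MeasurableSpace Ω] {μ : Measure Ω}
    (V : ℕ ⊕ ℕ → Ω → F) (hV_meas : ∀ i, Measurable (V i))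
    (hV_indep : iIndepFun V μ) (φ : F → ℝ) (hφ : Measurable φ) (n m : ℕ)
    (c d : ℝ → ℝ) (hc : Measurable c) (hd : Measurable d) :
    IndepFun (fun ω => c (∑ i ∈ Finset.range n, φ (V (Sum.inl i) ω)))
      (fun ω => d (∑ i ∈ Finset.range m, φ (V (Sum.inr i) ω))) μ := by
  have h := hV_indep.indepFun_finset ((Finset.range n).map Function.Embedding.inl)
    ((Finset.range m).map Function.Embedding.inr) (by
      rw [Finset.disjoint_left]; intro x hx hy
      simp only [Finset.mem_map] at hx hy
      obtain ⟨i, -, rfl⟩ := hx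
      obtain ⟨k, -, hk⟩ := hy
      simp at hk) hV_meas
  have h' := h.comp (φ := fun x => c (∑ i, φ (x i))) (ψ := fun x => d (∑ i, φ (x i)))
    (by fun_prop) (by fun_prop)
  convert! h' using 1
  · ext ω
    simp only [Function.comp]
    rw [Finset.sum_coe_sort ((Finset.range n).map Function.Embedding.inl) (fun i => φ (V i ω))]
    simp
  · ext ω
    simp only [Function.comp]
    rw [Finset.sum_coe_sort ((Finset.range m).map Function.Embedding.inr) (fun i => φ (V i ω))]
    simp

lemma c_aux (n m : ℕ → ℕ) (hn : Tendsto n atTop atTop) 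
    (ρ : ℝ) (hρ0 : 0 < ρ)
    (hratio : Tendsto (fun j => (n j : ℝ) / ((n j : ℝ) + (m j : ℝ))) atTop (nhds ρ)) :
    Tendsto (fun j => √((n j : ℝ) + (m j : ℝ)) * (√(n j : ℝ))⁻¹) atTop (nhds √(ρ⁻¹)) := by
  have := (hratio.inv₀ hρ0.ne').sqrt
  refine this.congr fun j => ?_
  rw [inv_div, Real.sqrt_div (by positivity), div_eq_mul_inv]

lemma d_aux (n m : ℕ → ℕ) (hn : Tendsto n atTop atTop) 
    (ρ : ℝ) (hρ0 : 0 < ρ)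
    (hratio : Tendsto (fun j => (n j : ℝ) / ((n j : ℝ) + (m j : ℝ))) atTop (nhds ρ)) :
    Tendsto (fun j => √((n j : ℝ) + (m j : ℝ)) * (n j : ℝ)⁻¹) atTop (nhds 0) := by
  have h1 := c_aux n m hn ρ hρ0 hratio
  have h2 : Tendsto (fun j => (√(n j : ℝ))⁻¹) atTop (nhds 0) :=
    tendsto_inv_atTop_zero.comp (Real.tendsto_sqrt_atTop.comp
      (tendsto_natCast_atTop_atTop.comp hn))
  have h3 := h1.mul h2
  rw [mul_zero] at h3
  refine h3.congr fun j => ?_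
  rw [mul_assoc, ← mul_inv, Real.mul_self_sqrt (by positivity)]

lemma ratio_aux (n m : ℕ → ℕ) (hn : Tendsto n atTop atTop) (ρ : ℝ)
    (hratio : Tendsto (fun j => (n j : ℝ) / ((n j : ℝ) + (m j : ℝ))) atTop (nhds ρ)) :
    Tendsto (fun j => (m j : ℝ) / ((m j : ℝ) + (n j : ℝ))) atTop (nhds (1 - ρ)) := by
  refine (hratio.const_sub 1).congr' ?_
  filter_upwards [hn.eventually_gt_atTop 0] with j hj
  have : (0:ℝ) < n j := by exact_mod_cast hj
  have : (0:ℝ) ≤ m j := by positivity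
  field_simp
  ring


theorem stmt5 {F : Type*} [NormedAddCommGroup F] [InnerProductSpace ℝ F] [CompleteSpace F]
    [SecondCountableTopology F] [MeasurableSpace F] [BorelSpace F]
    {Ω : Type*} [MeasurableSpace Ω] (μ : Measure Ω) [IsProbabilityMeasure μ]
    -- `V (Sum.inl i) = U i` and `V (Sum.inr j) = W j`: the combined family is jointly
    -- independent, the `U`'s identically distributed, and the `W`'s identically distributed.
    (V : ℕ ⊕ ℕ → Ω → F) (hV_meas : ∀ i, Measurable (V i))
    (hV_indep : iIndepFun V μ)
    (hU_ident : ∀ i, Measure.map (V (Sum.inl i)) μ = Measure.map (V (Sum.inl 0)) μ)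
    (hW_ident : ∀ j, Measure.map (V (Sum.inr j)) μ = Measure.map (V (Sum.inr 0)) μ)
    (hU_sq : Integrable (fun ω => ‖V (Sum.inl 0) ω‖ ^ 2) μ)
    (hW_sq : Integrable (fun ω => ‖V (Sum.inr 0) ω‖ ^ 2) μ)
    (a b : F) (ha : a = ∫ ω, V (Sum.inl 0) ω ∂μ) (hb : b = ∫ ω, V (Sum.inr 0) ω ∂μ)
    (n m : ℕ → ℕ) (hn : Tendsto n atTop atTop) (hm : Tendsto m atTop atTop)
    (ρ : ℝ) (hρ0 : 0 < ρ) (hρ1 : ρ < 1)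
    (hratio : Tendsto (fun j => (n j : ℝ) / ((n j : ℝ) + (m j : ℝ))) atTop (nhds ρ)) :
    ∀ f : BoundedContinuousFunction ℝ ℝ,
      Tendsto (fun j => ∫ ω, f (Real.sqrt ((n j : ℝ) + (m j : ℝ)) *
          (‖((n j : ℝ))⁻¹ • (∑ i : Fin (n j), V (Sum.inl i) ω)
              - ((m j : ℝ))⁻¹ • (∑ i : Fin (m j), V (Sum.inr i) ω)‖ ^ 2
            - ‖a - b‖ ^ 2)) ∂μ)
        atTop
        (nhds (∫ x, f x ∂(gaussianReal 0 (Real.toNNReal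
          (4 * ρ⁻¹ * variance (fun ω => (inner ℝ (a - b) (V (Sum.inl 0) ω) : ℝ)) μ
            + 4 * (1 - ρ)⁻¹ * variance (fun ω => (inner ℝ (a - b) (V (Sum.inr 0) ω) : ℝ)) μ))))) := by
  set D := a - b with hD
  let φ : F → ℝ := fun x => inner ℝ D x
  have hφ : Measurable φ := by fun_prop
  have idU : ∀ i, IdentDistrib (V (Sum.inl i)) (V (Sum.inl 0)) μ μ := fun i =>
    ⟨(hV_meas _).aemeasurable, (hV_meas _).aemeasurable, hU_ident i⟩
  have idW : ∀ i, IdentDistrib (V (Sum.inr i)) (V (Sum.inr 0)) μ μ := fun i =>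
    ⟨(hV_meas _).aemeasurable, (hV_meas _).aemeasurable, hW_ident i⟩
  have indU : iIndepFun (fun i => V (Sum.inl i)) μ := hV_indep.precomp Sum.inl_injective
  have indW : iIndepFun (fun i => V (Sum.inr i)) μ := hV_indep.precomp Sum.inr_injective
  have LU : MemLp (V (Sum.inl 0)) 2 μ :=
    (memLp_two_iff_integrable_sq_norm (hV_meas _).aestronglyMeasurable).2 hU_sq
  have LW : MemLp (V (Sum.inr 0)) 2 μ :=
    (memLp_two_iff_integrable_sq_norm (hV_meas _).aestronglyMeasurable).2 hW_sq
  have hratio' := ratio_aux n m hn ρ hratio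
  have hρ1' : 0 < 1 - ρ := by linarith
  -- inner products
  have pU : ∫ ω, φ (V (Sum.inl 0) ω) ∂μ = inner ℝ D a := by
    rw [ha]; exact integral_inner (LU.integrable one_le_two) D
  have pW : ∫ ω, φ (V (Sum.inr 0) ω) ∂μ = inner ℝ D b := by
    rw [hb]; exact integral_inner (LW.integrable one_le_two) D
  -- linear part
  let A : ℕ → Ω → ℝ := fun j ω => (2 * (√((n j : ℝ) + m j) * (√(n j : ℝ))⁻¹)) *
    ((√(n j : ℝ))⁻¹ * (∑ i ∈ Finset.range (n j), φ (V (Sum.inl i) ω) -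
      n j * ∫ ω, φ (V (Sum.inl 0) ω) ∂μ))
  let B : ℕ → Ω → ℝ := fun j ω => (-2 * (√((m j : ℝ) + n j) * (√(m j : ℝ))⁻¹)) *
    ((√(m j : ℝ))⁻¹ * (∑ i ∈ Finset.range (m j), φ (V (Sum.inr i) ω) -
      m j * ∫ ω, φ (V (Sum.inr 0) ω) ∂μ))
  have mA : ∀ j, Measurable (A j) := by intro j; fun_prop
  have mB : ∀ j, Measurable (B j) := by intro j; fun_prop
  have hAB : ∀ j, IndepFun (A j) (B j) μ := fun j =>
    indep_aux V hV_meas hV_indep φ hφ (n j) (m j)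
      (fun x => (2 * (√((n j : ℝ) + m j) * (√(n j : ℝ))⁻¹)) *
        ((√(n j : ℝ))⁻¹ * (x - n j * ∫ ω, φ (V (Sum.inl 0) ω) ∂μ)))
      (fun x => (-2 * (√((m j : ℝ) + n j) * (√(m j : ℝ))⁻¹)) *
        ((√(m j : ℝ))⁻¹ * (x - m j * ∫ ω, φ (V (Sum.inr 0) ω) ∂μ)))
      (by fun_prop) (by fun_prop)
  have cA := clt_aux (X := fun i ω => φ (V (Sum.inl i) ω)) (indU.comp (fun _ => φ) (fun _ => hφ))
    (fun i => (idU i).comp hφ) (LU.const_inner D) n hn _ _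
    ((c_aux n m hn ρ hρ0 hratio).const_mul 2)
  have cB := clt_aux (X := fun i ω => φ (V (Sum.inr i) ω)) (indW.comp (fun _ => φ) (fun _ => hφ))
    (fun i => (idW i).comp hφ) (LW.const_inner D) m hm _ _
    ((c_aux m n hm (1 - ρ) hρ1' hratio').const_mul (-2))
  set vU := variance (fun ω => (inner ℝ D (V (Sum.inl 0) ω) : ℝ)) μ with hvU
  set vW := variance (fun ω => (inner ℝ D (V (Sum.inr 0) ω) : ℝ)) μ with hvW
  have vU0 : 0 ≤ vU := variance_nonneg _ _
  have vW0 : 0 ≤ vW := variance_nonneg _ _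
  set v := Real.toNNReal (4 * ρ⁻¹ * vU + 4 * (1 - ρ)⁻¹ * vW) with hv
  have hX : TendstoInDistribution (fun j => A j + B j) atTop id (fun _ => μ) (gaussianReal 0 v) := by
    refine ⟨fun j => ((mA j).add (mB j)).aemeasurable, by fun_prop, ?_⟩
    refine ProbabilityMeasure.tendsto_iff_tendsto_charFun.2 fun t => ?_
    simp only [ProbabilityMeasure.coe_mk, Measure.map_id]
    have e1 : charFun (gaussianReal 0 v) t =
        charFun (gaussianReal 0 ((2 * √(ρ⁻¹)) ^ 2 * vU).toNNReal) t *
        charFun (gaussianReal 0 ((-2 * √((1 - ρ)⁻¹)) ^ 2 * vW).toNNReal) t := by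
      have e2 : (2 * √(ρ⁻¹)) ^ 2 = 4 * ρ⁻¹ := by
        rw [mul_pow, Real.sq_sqrt (by positivity)]; norm_num
      have e3 : (-2 * √((1 - ρ)⁻¹)) ^ 2 = 4 * (1 - ρ)⁻¹ := by
        rw [mul_pow, Real.sq_sqrt (by positivity)]; norm_num
      rw [e2, e3, ← charFun_conv, gaussianReal_conv_gaussianReal, hv,
        Real.toNNReal_add (by positivity) (by positivity), add_zero]
    rw [e1]
    refine ((cA t).mul (cB t)).congr fun j => ?_
    rw [(hAB j).charFun_map_add_eq_mul (mA j).aemeasurable (mB j).aemeasurable]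
    rfl
  -- remainder
  let SU : ℕ → Ω → F := fun k ω => ∑ i ∈ Finset.range k, (V (Sum.inl i) ω - a)
  let SW : ℕ → Ω → F := fun k ω => ∑ i ∈ Finset.range k, (V (Sum.inr i) ω - b)
  have LUa : MemLp (fun ω => V (Sum.inl 0) ω - a) 2 μ := LU.sub (memLp_const a)
  have LWb : MemLp (fun ω => V (Sum.inr 0) ω - b) 2 μ := LW.sub (memLp_const b)
  have idUa : ∀ i, IdentDistrib (fun ω => V (Sum.inl i) ω - a) (fun ω => V (Sum.inl 0) ω - a) μ μ :=
    fun i => (idU i).comp (u := fun x => x - a) (by fun_prop)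
  have idWb : ∀ i, IdentDistrib (fun ω => V (Sum.inr i) ω - b) (fun ω => V (Sum.inr 0) ω - b) μ μ :=
    fun i => (idW i).comp (u := fun x => x - b) (by fun_prop)
  have mSU : ∀ k, MemLp (SU k) 2 μ := fun k =>
    memLp_finsetSum _ fun i _ => (idUa i).memLp_iff.2 LUa
  have mSW : ∀ k, MemLp (SW k) 2 μ := fun k =>
    memLp_finsetSum _ fun i _ => (idWb i).memLp_iff.2 LWb
  have eU : ∀ k : ℕ, ∫ ω, ‖SU k ω‖ ^ 2 ∂μ = k * ∫ ω, ‖V (Sum.inl 0) ω - a‖ ^ 2 ∂μ := fun k =>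
    secmom_aux (X := fun i ω => V (Sum.inl i) ω - a) (fun i => (hV_meas _).sub_const a)
      (indU.comp (fun _ x => x - a) (fun _ => by fun_prop)) idUa
      (by rw [integral_sub (LU.integrable one_le_two) (integrable_const a), ← ha]; simp) LUa k
  have eW : ∀ k : ℕ, ∫ ω, ‖SW k ω‖ ^ 2 ∂μ = k * ∫ ω, ‖V (Sum.inr 0) ω - b‖ ^ 2 ∂μ := fun k =>
    secmom_aux (X := fun i ω => V (Sum.inr i) ω - b) (fun i => (hV_meas _).sub_const b)
      (indW.comp (fun _ x => x - b) (fun _ => by fun_prop)) idWb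
      (by rw [integral_sub (LW.integrable one_le_two) (integrable_const b), ← hb]; simp) LWb k
  set sU := ∫ ω, ‖V (Sum.inl 0) ω - a‖ ^ 2 ∂μ
  set sW := ∫ ω, ‖V (Sum.inr 0) ω - b‖ ^ 2 ∂μ
  let Y : ℕ → Ω → ℝ := fun j ω => Real.sqrt ((n j : ℝ) + (m j : ℝ)) *
          (‖((n j : ℝ))⁻¹ • (∑ i : Fin (n j), V (Sum.inl i) ω)
              - ((m j : ℝ))⁻¹ • (∑ i : Fin (m j), V (Sum.inr i) ω)‖ ^ 2
            - ‖D‖ ^ 2)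
  have mY : ∀ j, Measurable (Y j) := by intro j; fun_prop
  have key : ∀ j, 0 < n j → 0 < m j → ∀ ω, Y j ω - (A j ω + B j ω) =
      √((n j : ℝ) + m j) * ‖((n j : ℝ))⁻¹ • SU (n j) ω - ((m j : ℝ))⁻¹ • SW (m j) ω‖ ^ 2 := by
    intro j hnj hmj ω
    have hn0 : (0:ℝ) < n j := by exact_mod_cast hnj
    have hm0 : (0:ℝ) < m j := by exact_mod_cast hmj
    have hSU : ((n j : ℝ))⁻¹ • SU (n j) ω =
        ((n j : ℝ))⁻¹ • (∑ i : Fin (n j), V (Sum.inl i) ω) - a := by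
      simp only [SU, Finset.sum_sub_distrib, Finset.sum_const, Finset.card_range, smul_sub]
      rw [← Nat.cast_smul_eq_nsmul ℝ, inv_smul_smul₀ hn0.ne',
        Finset.sum_range (fun i => V (Sum.inl i) ω)]
    have hSW : ((m j : ℝ))⁻¹ • SW (m j) ω =
        ((m j : ℝ))⁻¹ • (∑ i : Fin (m j), V (Sum.inr i) ω) - b := by
      simp only [SW, Finset.sum_sub_distrib, Finset.sum_const, Finset.card_range, smul_sub]
      rw [← Nat.cast_smul_eq_nsmul ℝ, inv_smul_smul₀ hm0.ne',
        Finset.sum_range (fun i => V (Sum.inr i) ω)]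
    have hA : A j ω = √((n j : ℝ) + m j) * (2 * inner ℝ D (((n j : ℝ))⁻¹ • SU (n j) ω)) := by
      have h1 : inner ℝ D (SU (n j) ω) =
          ∑ i ∈ Finset.range (n j), φ (V (Sum.inl i) ω) - n j * inner ℝ D a := by
        simp [SU, φ, inner_sum, inner_sub_right, ← Nat.cast_smul_eq_nsmul ℝ, inner_smul_right]
      simp only [A]
      rw [inner_smul_right, h1, pU]
      have h2 : (√(n j : ℝ))⁻¹ * (√(n j : ℝ))⁻¹ = (n j : ℝ)⁻¹ := by
        rw [← mul_inv, Real.mul_self_sqrt hn0.le]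
      rw [← h2]; ring
    have hB : B j ω = -(√((n j : ℝ) + m j) * (2 * inner ℝ D (((m j : ℝ))⁻¹ • SW (m j) ω))) := by
      have h1 : inner ℝ D (SW (m j) ω) =
          ∑ i ∈ Finset.range (m j), φ (V (Sum.inr i) ω) - m j * inner ℝ D b := by
        simp [SW, φ, inner_sum, inner_sub_right, ← Nat.cast_smul_eq_nsmul ℝ, inner_smul_right]
      simp only [B]
      rw [inner_smul_right, h1, pW]
      have h2 : (√(m j : ℝ))⁻¹ * (√(m j : ℝ))⁻¹ = (m j : ℝ)⁻¹ := by
        rw [← mul_inv, Real.mul_self_sqrt hm0.le]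
      rw [← h2, add_comm (m j : ℝ) (n j : ℝ)]; ring
    have hY : Y j ω = √((n j : ℝ) + m j) *
        (‖D + (((n j : ℝ))⁻¹ • SU (n j) ω - ((m j : ℝ))⁻¹ • SW (m j) ω)‖ ^ 2 - ‖D‖ ^ 2) := by
      simp only [Y]
      rw [hSU, hSW, hD]
      congr 4
      abel
    rw [hY, hA, hB, norm_add_sq_real, inner_sub_right]
    ring
  let G : ℕ → Ω → ℝ := fun j ω => 2 * √((n j : ℝ) + m j) *
    ((n j : ℝ)⁻¹ ^ 2 * ‖SU (n j) ω‖ ^ 2 + (m j : ℝ)⁻¹ ^ 2 * ‖SW (m j) ω‖ ^ 2)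
  have iU : ∀ k, Integrable (fun ω => ‖SU k ω‖ ^ 2) μ := fun k => (mSU k).norm.integrable_sq
  have iW : ∀ k, Integrable (fun ω => ‖SW k ω‖ ^ 2) μ := fun k => (mSW k).norm.integrable_sq
  have hG : ∀ j, Integrable (G j) μ := fun j =>
    (((iU _).const_mul _).add ((iW _).const_mul _)).const_mul _
  have hGlim : Tendsto (fun j => ∫ ω, G j ω ∂μ) atTop (nhds 0) := by
    have h1 := ((d_aux n m hn ρ hρ0 hratio).mul_const sU).const_mul 2
    have h2 := ((d_aux m n hm (1 - ρ) hρ1' hratio').mul_const sW).const_mul 2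
    have h3 := h1.add h2
    simp only [zero_mul, mul_zero, add_zero] at h3
    refine h3.congr' ?_
    filter_upwards [hn.eventually_gt_atTop 0, hm.eventually_gt_atTop 0] with j hnj hmj
    have hn0 : (0:ℝ) < n j := by exact_mod_cast hnj
    have hm0 : (0:ℝ) < m j := by exact_mod_cast hmj
    simp only [G]
    rw [integral_const_mul, integral_add ((iU _).const_mul _) ((iW _).const_mul _),
      integral_const_mul, integral_const_mul, eU, eW, add_comm (m j : ℝ) (n j : ℝ)]
    field_simp
  have hR : TendstoInMeasure μ (Y - fun j => A j + B j) atTop 0 := by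
    refine tim_aux _ G hG ?_ hGlim
    filter_upwards [hn.eventually_gt_atTop 0, hm.eventually_gt_atTop 0] with j hnj hmj ω
    have := key j hnj hmj ω
    simp only [Pi.sub_apply, Pi.add_apply]
    rw [this, abs_of_nonneg (by positivity)]
    simp only [G]
    rw [mul_comm 2, mul_assoc]
    refine mul_le_mul_of_nonneg_left ?_ (by positivity)
    have h1 := parallelogram_law_with_norm ℝ (((n j : ℝ))⁻¹ • SU (n j) ω)
      (((m j : ℝ))⁻¹ • SW (m j) ω)
    have h2 : ‖((n j : ℝ))⁻¹ • SU (n j) ω‖ ^ 2 = (n j : ℝ)⁻¹ ^ 2 * ‖SU (n j) ω‖ ^ 2 := by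
      rw [norm_smul, mul_pow]; simp
    have h3 : ‖((m j : ℝ))⁻¹ • SW (m j) ω‖ ^ 2 = (m j : ℝ)⁻¹ ^ 2 * ‖SW (m j) ω‖ ^ 2 := by
      rw [norm_smul, mul_pow]; simp
    rw [← h2, ← h3]
    nlinarith [sq_nonneg ‖((n j : ℝ))⁻¹ • SU (n j) ω + ((m j : ℝ))⁻¹ • SW (m j) ω‖]
  have hfin := tendstoInDistribution_of_tendstoInMeasure_sub Y id hX hR
    (fun j => (mY j).aemeasurable)
  intro f
  have h := ProbabilityMeasure.tendsto_iff_forall_integral_tendsto.1 hfin.tendsto f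
  simp only [ProbabilityMeasure.coe_mk, Measure.map_id] at h
  refine h.congr fun j => ?_
  rw [integral_map (mY j).aemeasurable (by fun_prop)]
end

section
/- Let (𝓗, 𝒜, P) be a probability space and h : 𝓗×𝓗 → ℝ a measurable symmetric function satisfying the degeneracy condition ∫h(x,y)dP(y) = 0 for all x ∈ 𝓗, with ∫h(x,x)²dP(x) < ∞ and ∫∫h(x,y)²dP(x)dP(y) < ∞. Let X₁,…,Xₙ, Y₁,…,Yₘ be i.i.d. with law P and set W_{n,m} = (n+m)·[(1/n²)∑_{i,s=1}^n h(X_i,X_s) + (1/m²)∑_{j,t=1}^m h(Y_j,Y_t) − (2/nm)∑_{i=1}^n∑_{j=1}^m h(X_i,Y_j)]. Then for any sequences n_j, m_j → ∞ with n_j/(n_j+m_j) → ρ ∈ (0,1), there exist a constant C ≥ 0 and an index J such that for all j ≥ J, |Var(W_{n_j,m_j}) − (2(n_j+m_j)⁴/(n_j²m_j²))·∫∫h(x,y)²dP(x)dP(y)| ≤ C·(1/n_j + 1/m_j). (With h = h_P built from a kernel k, ∫∫h² dPdP equals the squared Hilbert–Schmidt norm ‖Υ‖² of Υ = V_{X∼P}[(k(·,X)−μ_k(P))^{⊗2}],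 and W_{n,m} = (n+m)T̂²_{n,m}; this is the variance expansion of the MVD statistic under the null hypothesis.) -/
open MeasureTheory ProbabilityTheory Filter

/-- The two-sample degenerate V-statistic `W_{n,m}` built from a kernel `h` and the first `n`
`X`-samples and `m` `Y`-samples. -/
noncomputable def Wstat {H : Type*} {Ω : Type*} (h : H → H → ℝ)
    (X Y : ℕ → Ω → H) (n m : ℕ) (ω : Ω) : ℝ :=
  ((n : ℝ) + (m : ℝ)) *
    (((n : ℝ) ^ 2)⁻¹ * ∑ i : Fin n, ∑ s : Fin n, h (X i ω) (X s ω)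
      + ((m : ℝ) ^ 2)⁻¹ * ∑ j : Fin m, ∑ t : Fin m, h (Y j ω) (Y t ω)
      - 2 * ((n : ℝ) * (m : ℝ))⁻¹ * ∑ i : Fin n, ∑ j : Fin m, h (X i ω) (Y j ω))

section aux
set_option linter.unusedSectionVars false
variable {H : Type*} [MeasurableSpace H] {P : Measure H} [IsProbabilityMeasure P]
    {h : H → H → ℝ} {Ω : Type*} [MeasurableSpace Ω] {μ : Measure Ω} [IsProbabilityMeasure μ]
    {ι : Type*} [DecidableEq ι] {Z : ι → Ω → H}

lemma aux_key_T {E : Type*} [MeasurableSpace E] (T : Ω → E) (hT : Measurable T)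
    (Y : Ω → H) (hY : Measurable Y) (hYP : Measure.map Y μ = P)
    (hind : IndepFun T Y μ) (G : E × H → ℝ) (hG : Measurable G)
    (h0 : ∀ t, ∫ y, G (t, y) ∂P = 0) : ∫ ω, G (T ω, Y ω) ∂μ = 0 := by
  have e : ∫ ω, G (T ω, Y ω) ∂μ = ∫ p, G p ∂(Measure.map (fun ω => (T ω, Y ω)) μ) :=
    (integral_map (hT.prodMk hY).aemeasurable hG.aestronglyMeasurable).symm
  rw [e, (indepFun_iff_map_prod_eq_prod_map_map hT.aemeasurable hY.aemeasurable).1 hind, hYP]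
  have : IsProbabilityMeasure (Measure.map T μ) :=
    Measure.isProbabilityMeasure_map hT.aemeasurable
  by_cases hi : Integrable G ((Measure.map T μ).prod P)
  · rw [integral_prod _ hi]; simp [h0]
  · exact integral_undef hi

lemma aux_key (h_meas : Measurable (Function.uncurry h)) (h_deg : ∀ x, ∫ y, h x y ∂P = 0)
    (hZ_meas : ∀ i, Measurable (Z i)) (hZ_indep : iIndepFun Z μ)
    (hZ_law : ∀ i, Measure.map (Z i) μ = P) (a b c d : ι) (hab : a ≠ b) (hcb : c ≠ b)
    (hdb : d ≠ b) : ∫ ω, h (Z a ω) (Z b ω) * h (Z c ω) (Z d ω) ∂μ = 0 := by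
  have hd : Disjoint ({a, c, d} : Finset ι) {b} := by
    simp [hab.symm, hcb.symm, hdb.symm]
  have hI := hZ_indep.indepFun_finset {a, c, d} {b} hd hZ_meas
  have hI2 : IndepFun (fun ω => (Z a ω, (Z c ω, Z d ω))) (Z b) μ := by
    have := hI.comp
      (φ := fun f : (({a, c, d} : Finset ι) → H) =>
        (f ⟨a, by simp⟩, (f ⟨c, by simp⟩, f ⟨d, by simp⟩)))
      (ψ := fun f : (({b} : Finset ι) → H) => f ⟨b, by simp⟩)
      (by fun_prop) (measurable_pi_apply (X := fun _ : (({b} : Finset ι)) => H) _)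
    exact this
  refine aux_key_T (P := P) (fun ω => (Z a ω, (Z c ω, Z d ω))) ?_ (Z b) (hZ_meas b) (hZ_law b) hI2
    (fun p => h p.1.1 p.2 * h p.1.2.1 p.1.2.2) ?_ ?_
  · exact (hZ_meas a).prodMk ((hZ_meas c).prodMk (hZ_meas d))
  · have h1 : Measurable (fun p : (H × (H × H)) × H => Function.uncurry h (p.1.1, p.2)) :=
      h_meas.comp (by fun_prop)
    have h2 : Measurable (fun p : (H × (H × H)) × H => Function.uncurry h p.1.2) :=
      h_meas.comp (by fun_prop)
    exact h1.mul h2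
  · intro t
    simp only [integral_mul_const, h_deg, zero_mul]

lemma aux_pair (hZ_meas : ∀ i, Measurable (Z i)) (hZ_indep : iIndepFun Z μ)
    (hZ_law : ∀ i, Measure.map (Z i) μ = P) (a b : ι) (hab : a ≠ b) :
    Measure.map (fun ω => (Z a ω, Z b ω)) μ = P.prod P := by
  rw [(indepFun_iff_map_prod_eq_prod_map_map (hZ_meas a).aemeasurable
    (hZ_meas b).aemeasurable).1 (hZ_indep.indepFun hab), hZ_law, hZ_law]

lemma aux_mean (h_meas : Measurable (Function.uncurry h)) (h_deg : ∀ x, ∫ y, h x y ∂P = 0)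
    (hZ_meas : ∀ i, Measurable (Z i)) (hZ_indep : iIndepFun Z μ)
    (hZ_law : ∀ i, Measure.map (Z i) μ = P) (a b : ι) (hab : a ≠ b) :
    ∫ ω, h (Z a ω) (Z b ω) ∂μ = 0 :=
  aux_key_T (P := P) (Z a) (hZ_meas a) (Z b) (hZ_meas b) (hZ_law b) (hZ_indep.indepFun hab)
    (Function.uncurry h) h_meas h_deg

lemma aux_diag_meas (h_meas : Measurable (Function.uncurry h)) : Measurable (fun x => h x x) :=
  h_meas.comp (measurable_id.prodMk measurable_id)

lemma aux_U_meas (h_meas : Measurable (Function.uncurry h))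
    (hZ_meas : ∀ i, Measurable (Z i)) (a b : ι) : Measurable (fun ω => h (Z a ω) (Z b ω)) :=
  h_meas.comp ((hZ_meas a).prodMk (hZ_meas b))

lemma aux_memLp (h_meas : Measurable (Function.uncurry h))
    (h_diag_sq_int : Integrable (fun x => (h x x) ^ 2) P)
    (h_sq_int : Integrable (fun p : H × H => (h p.1 p.2) ^ 2) (P.prod P))
    (hZ_meas : ∀ i, Measurable (Z i)) (hZ_indep : iIndepFun Z μ)
    (hZ_law : ∀ i, Measure.map (Z i) μ = P) (a b : ι) :
    MemLp (fun ω => h (Z a ω) (Z b ω)) 2 μ := by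
  rw [memLp_two_iff_integrable_sq (aux_U_meas h_meas hZ_meas a b).aestronglyMeasurable]
  by_cases hab : a = b
  · subst hab
    rw [← hZ_law a] at h_diag_sq_int
    exact h_diag_sq_int.comp_measurable (hZ_meas a)
  · rw [← aux_pair hZ_meas hZ_indep hZ_law a b hab] at h_sq_int
    exact h_sq_int.comp_measurable ((hZ_meas a).prodMk (hZ_meas b))

lemma aux_sq (h_meas : Measurable (Function.uncurry h))
    (h_sq_int : Integrable (fun p : H × H => (h p.1 p.2) ^ 2) (P.prod P))
    (hZ_meas : ∀ i, Measurable (Z i)) (hZ_indep : iIndepFun Z μ)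
    (hZ_law : ∀ i, Measure.map (Z i) μ = P) (a b : ι) (hab : a ≠ b) :
    ∫ ω, h (Z a ω) (Z b ω) * h (Z a ω) (Z b ω) ∂μ = ∫ x, ∫ y, (h x y) ^ 2 ∂P ∂P := by
  have e : ∫ p, (h p.1 p.2) ^ 2 ∂(Measure.map (fun ω => (Z a ω, Z b ω)) μ)
      = ∫ ω, (h (Z a ω) (Z b ω)) ^ 2 ∂μ :=
    integral_map (f := fun p : H × H => (h p.1 p.2) ^ 2)
      ((hZ_meas a).prodMk (hZ_meas b)).aemeasurable (h_meas.pow_const 2).aestronglyMeasurable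
  simp only [← pow_two]
  rw [← e, aux_pair hZ_meas hZ_indep hZ_law a b hab, integral_prod _ h_sq_int]

lemma aux_cov (h_meas : Measurable (Function.uncurry h)) (h_symm : ∀ x y, h x y = h y x)
    (h_deg : ∀ x, ∫ y, h x y ∂P = 0)
    (h_diag_sq_int : Integrable (fun x => (h x x) ^ 2) P)
    (h_sq_int : Integrable (fun p : H × H => (h p.1 p.2) ^ 2) (P.prod P))
    (hZ_meas : ∀ i, Measurable (Z i)) (hZ_indep : iIndepFun Z μ)
    (hZ_law : ∀ i, Measure.map (Z i) μ = P) (a b c d : ι) :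
    covariance (fun ω => h (Z a ω) (Z b ω)) (fun ω => h (Z c ω) (Z d ω)) μ
      = (∫ x, ∫ y, (h x y) ^ 2 ∂P ∂P) * (if a = c then 1 else 0) * (if b = d then 1 else 0)
      + (∫ x, ∫ y, (h x y) ^ 2 ∂P ∂P) * (if a = d then 1 else 0) * (if b = c then 1 else 0)
      + (variance (fun x => h x x) P - 2 * ∫ x, ∫ y, (h x y) ^ 2 ∂P ∂P)
        * (if a = b then 1 else 0) * (if a = c then 1 else 0) * (if a = d then 1 else 0) := by
  have hL := aux_memLp h_meas h_diag_sq_int h_sq_int hZ_meas hZ_indep hZ_law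
  have hK := aux_key h_meas h_deg hZ_meas hZ_indep hZ_law
  have hM := aux_mean h_meas h_deg hZ_meas hZ_indep hZ_law
  have hS := aux_sq h_meas h_sq_int hZ_meas hZ_indep hZ_law
  set G := ∫ x, ∫ y, (h x y) ^ 2 ∂P ∂P with hG
  -- covariance with an off-diagonal term vanishes without a match
  have hcov : ∀ a b c d, a ≠ b → covariance (fun ω => h (Z a ω) (Z b ω))
      (fun ω => h (Z c ω) (Z d ω)) μ = ∫ ω, h (Z a ω) (Z b ω) * h (Z c ω) (Z d ω) ∂μ := by
    intro a b c d hab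
    rw [covariance_eq_sub (hL a b) (hL c d), hM a b hab]
    simp
  have hzero : ∀ a b c d, a ≠ b → ¬ (a = c ∧ b = d) → ¬ (a = d ∧ b = c) →
      covariance (fun ω => h (Z a ω) (Z b ω)) (fun ω => h (Z c ω) (Z d ω)) μ = 0 := by
    intro a b c d hab h1 h2
    rw [hcov a b c d hab]
    by_cases hb : c ≠ b ∧ d ≠ b
    · exact hK a b c d hab hb.1 hb.2
    · have : c ≠ a ∧ d ≠ a := by grind
      have := hK b a c d hab.symm this.1 this.2
      rw [← this]
      congr 1
      ext ω
      rw [h_symm (Z a ω)]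
  by_cases hab : a = b
  · subst hab
    by_cases hcd : c = d
    · subst hcd
      by_cases hac : a = c
      · subst hac
        rw [covariance_self (aux_U_meas h_meas hZ_meas a a).aemeasurable]
        have := variance_map (X := fun x => h x x) (Y := Z a) (μ := μ)
          (aux_diag_meas h_meas).aemeasurable (hZ_meas a).aemeasurable
        rw [hZ_law a] at this
        rw [this]
        simp only [if_true, Function.comp_def]
        ring
      · have hi := (hZ_indep.indepFun hac).comp (aux_diag_meas h_meas) (aux_diag_meas h_meas)
        have := hi.covariance_eq_zero (hL a a) (hL c c)
        simp only [Function.comp_def] at this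
        rw [this]
        simp [hac]
    · rw [covariance_comm, hzero c d a a hcd (by grind) (by grind)]
      by_cases hac : a = c
      · have : a ≠ d := by grind
        simp [this]
      · simp [hac]
  · by_cases h1 : a = c ∧ b = d
    · obtain ⟨rfl, rfl⟩ := h1
      rw [hcov a b a b hab, hS a b hab]
      simp [hab]
    · by_cases h2 : a = d ∧ b = c
      · obtain ⟨rfl, rfl⟩ := h2
        rw [hcov a b b a hab, ← hS a b hab]
        simp only [hab, if_true, if_false, mul_zero, zero_mul, mul_one, zero_add, add_zero]
        congr 1
        ext ω
        rw [h_symm (Z b ω)]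
      · rw [hzero a b c d hab h1 h2]
        grind

lemma aux_var [Fintype ι] (h_meas : Measurable (Function.uncurry h))
    (h_symm : ∀ x y, h x y = h y x)
    (h_deg : ∀ x, ∫ y, h x y ∂P = 0)
    (h_diag_sq_int : Integrable (fun x => (h x x) ^ 2) P)
    (h_sq_int : Integrable (fun p : H × H => (h p.1 p.2) ^ 2) (P.prod P))
    (hZ_meas : ∀ i, Measurable (Z i)) (hZ_indep : iIndepFun Z μ)
    (hZ_law : ∀ i, Measure.map (Z i) μ = P) (w : ι → ℝ) :
    variance (fun ω => ∑ p : ι × ι, (w p.1 * w p.2) * h (Z p.1 ω) (Z p.2 ω)) μ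
      = 2 * (∫ x, ∫ y, (h x y) ^ 2 ∂P ∂P) * (∑ a, w a ^ 2) ^ 2
      + (variance (fun x => h x x) P - 2 * ∫ x, ∫ y, (h x y) ^ 2 ∂P ∂P) * ∑ a, w a ^ 4 := by
  have hL := aux_memLp h_meas h_diag_sq_int h_sq_int hZ_meas hZ_indep hZ_law
  rw [variance_fun_sum (X := fun (p : ι × ι) ω => (w p.1 * w p.2) * h (Z p.1 ω) (Z p.2 ω))
    (fun p => (hL p.1 p.2).const_mul _)]
  simp only [covariance_const_mul_left, covariance_const_mul_right]
  simp only [aux_cov h_meas h_symm h_deg h_diag_sq_int h_sq_int hZ_meas hZ_indep hZ_law]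
  set G := ∫ x, ∫ y, (h x y) ^ 2 ∂P ∂P with hG
  set V := variance (fun x => h x x) P
  simp only [Fintype.sum_prod_type, mul_add, Finset.sum_add_distrib, mul_ite, mul_one, mul_zero,
    Finset.sum_ite_eq, Finset.mem_univ, if_true]
  have e1 : (∑ a, w a ^ 2) ^ 2 = ∑ a, ∑ b, w a ^ 2 * w b ^ 2 := by
    rw [pow_two, Finset.sum_mul_sum]
  have e2 : ∀ x y : ι, (∑ z, ∑ t, if y = z then if x = t then
      w z * w t * (w x * w y * G) else 0 else 0) = w x * w y * (w x * w y * G) := by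
    intro x y
    rw [Finset.sum_eq_single y (by intro b _ hb; simp [hb.symm]) (by simp)]
    simp only [if_true, Finset.sum_ite_eq, Finset.mem_univ]
    ring
  simp only [e2]
  rw [e1, Finset.mul_sum, Finset.mul_sum, ← Finset.sum_add_distrib, ← Finset.sum_add_distrib,
    ← Finset.sum_add_distrib]
  refine Finset.sum_congr rfl fun x _ => ?_
  rw [Finset.mul_sum, ← Finset.sum_add_distrib]
  congr 1
  · exact Finset.sum_congr rfl fun y _ => by ring
  · ring
end aux

theorem stmt8 {H : Type*} [MeasurableSpace H] (P : Measure H) [IsProbabilityMeasure P]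
    (h : H → H → ℝ) (h_meas : Measurable (Function.uncurry h))
    (h_symm : ∀ x y, h x y = h y x)
    (h_deg : ∀ x, ∫ y, h x y ∂P = 0)
    (h_diag_sq_int : Integrable (fun x => (h x x) ^ 2) P)
    (h_sq_int : Integrable (fun p : H × H => (h p.1 p.2) ^ 2) (P.prod P))
    {Ω : Type*} [MeasurableSpace Ω] (μ : Measure Ω) [IsProbabilityMeasure μ]
    (Z : ℕ ⊕ ℕ → Ω → H) (hZ_meas : ∀ i, Measurable (Z i))
    (hZ_indep : iIndepFun Z μ)
    (hZ_law : ∀ i, Measure.map (Z i) μ = P)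
    (n m : ℕ → ℕ) (hn : Tendsto n atTop atTop) (hm : Tendsto m atTop atTop)
    (ρ : ℝ) (hρ0 : 0 < ρ) (hρ1 : ρ < 1)
    (hratio : Tendsto (fun j => (n j : ℝ) / ((n j : ℝ) + (m j : ℝ))) atTop (nhds ρ)) :
    ∃ C : ℝ, 0 ≤ C ∧ ∃ J : ℕ, ∀ j ≥ J,
      |variance (Wstat h (fun i => Z (Sum.inl i)) (fun i => Z (Sum.inr i)) (n j) (m j)) μ
          - 2 * ((n j : ℝ) + (m j : ℝ)) ^ 4 / ((n j : ℝ) ^ 2 * (m j : ℝ) ^ 2)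
            * ∫ x, ∫ y, (h x y) ^ 2 ∂P ∂P|
        ≤ C * (1 / (n j : ℝ) + 1 / (m j : ℝ)) := by
  have hvar : ∀ n m : ℕ, 0 < n → 0 < m →
      variance (Wstat h (fun i => Z (Sum.inl i)) (fun i => Z (Sum.inr i)) n m) μ
        = ((n : ℝ) + m) ^ 2 * (2 * (∫ x, ∫ y, (h x y) ^ 2 ∂P ∂P) * (1 / (n : ℝ) + 1 / m) ^ 2
          + (variance (fun x => h x x) P - 2 * ∫ x, ∫ y, (h x y) ^ 2 ∂P ∂P)
            * (1 / (n : ℝ) ^ 3 + 1 / (m : ℝ) ^ 3)) := by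
    intro n m hn hm
    have hn' : (n : ℝ) ≠ 0 := by positivity
    have hm' : (m : ℝ) ≠ 0 := by positivity
    let g : Fin n ⊕ Fin m → ℕ ⊕ ℕ := Sum.map Fin.val Fin.val
    have hg : Function.Injective g := Fin.val_injective.sumMap Fin.val_injective
    let w : Fin n ⊕ Fin m → ℝ := Sum.elim (fun _ => (n : ℝ)⁻¹) (fun _ => -(m : ℝ)⁻¹)
    have key := aux_var (Z := fun i => Z (g i)) (μ := μ) h_meas h_symm h_deg h_diag_sq_int h_sq_int
      (fun i => hZ_meas (g i)) (hZ_indep.precomp hg) (fun i => hZ_law (g i)) w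
    have hW : Wstat h (fun i => Z (Sum.inl i)) (fun i => Z (Sum.inr i)) n m
        = fun ω => ((n : ℝ) + m) *
          ∑ p : (Fin n ⊕ Fin m) × (Fin n ⊕ Fin m), (w p.1 * w p.2) * h (Z (g p.1) ω) (Z (g p.2) ω) := by
      ext ω
      have hsw : ∑ j : Fin m, ∑ i : Fin n, h (Z (Sum.inr j) ω) (Z (Sum.inl i) ω)
          = ∑ i : Fin n, ∑ j : Fin m, h (Z (Sum.inl i) ω) (Z (Sum.inr j) ω) := by
        rw [Finset.sum_comm]
        simp only [h_symm (Z (Sum.inr _) ω) (Z (Sum.inl _) ω)]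
      simp only [Wstat, Fintype.sum_prod_type, Fintype.sum_sum_type, w, g, Sum.elim_inl,
        Sum.elim_inr, Sum.map_inl, Sum.map_inr, ← Finset.mul_sum, Finset.sum_add_distrib, hsw]
      field_simp
      ring
    rw [hW, variance_const_mul, key]
    congr 2
    · congr 2
      simp [w]
      field_simp
    · congr 1
      simp [w]
      field_simp
  set G := ∫ x, ∫ y, (h x y) ^ 2 ∂P ∂P with hG
  set K := variance (fun x => h x x) P - 2 * G with hK
  refine ⟨|K| * (4 / ρ ^ 2 + 4 / (1 - ρ) ^ 2), by positivity, ?_⟩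
  have ev : ∀ᶠ j in atTop, ρ / 2 < (n j : ℝ) / ((n j : ℝ) + (m j : ℝ)) ∧
      (n j : ℝ) / ((n j : ℝ) + (m j : ℝ)) < (1 + ρ) / 2 ∧ 0 < n j ∧ 0 < m j := by
    filter_upwards [hratio.eventually_const_lt (by linarith : ρ / 2 < ρ),
      hratio.eventually_lt_const (by linarith : ρ < (1 + ρ) / 2),
      hn.eventually_gt_atTop 0, hm.eventually_gt_atTop 0] with j h1 h2 h3 h4
    exact ⟨h1, h2, h3, h4⟩
  obtain ⟨J, hJ⟩ := eventually_atTop.1 ev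
  refine ⟨J, fun j hj => ?_⟩
  obtain ⟨h1, h2, h3, h4⟩ := hJ j hj
  rw [hvar _ _ h3 h4]
  have a0 : (0 : ℝ) < n j := by exact_mod_cast h3
  have b0 : (0 : ℝ) < m j := by exact_mod_cast h4
  generalize (n j : ℝ) = a at *
  generalize (m j : ℝ) = b at *
  have hr : 0 < 1 - ρ := by linarith
  rw [lt_div_iff₀ (by positivity)] at h1
  rw [div_lt_iff₀ (by positivity)] at h2
  have e : (a + b) ^ 2 * (2 * G * (1 / a + 1 / b) ^ 2 + K * (1 / a ^ 3 + 1 / b ^ 3))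
      - 2 * (a + b) ^ 4 / (a ^ 2 * b ^ 2) * G
      = K * (((a + b) / a) ^ 2 * (1 / a) + ((a + b) / b) ^ 2 * (1 / b)) := by
    field_simp
    ring
  have ha : ((a + b) / a) ^ 2 ≤ 4 / ρ ^ 2 := by
    have : (a + b) / a ≤ 2 / ρ := by
      rw [div_le_div_iff₀ a0 hρ0]; linarith
    calc ((a + b) / a) ^ 2 ≤ (2 / ρ) ^ 2 := by gcongr
      _ = _ := by ring
  have hb : ((a + b) / b) ^ 2 ≤ 4 / (1 - ρ) ^ 2 := by
    have : (a + b) / b ≤ 2 / (1 - ρ) := by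
      rw [div_le_div_iff₀ b0 hr]; linarith
    calc ((a + b) / b) ^ 2 ≤ (2 / (1 - ρ)) ^ 2 := by gcongr
      _ = _ := by rw [div_pow]; norm_num
  rw [e, abs_mul, mul_assoc, abs_of_nonneg (by positivity :
    0 ≤ ((a + b) / a) ^ 2 * (1 / a) + ((a + b) / b) ^ 2 * (1 / b))]
  refine mul_le_mul_of_nonneg_left ?_ (abs_nonneg K)
  have p1 : 0 < 4 / ρ ^ 2 := by positivity
  have p2 : 0 < 4 / (1 - ρ) ^ 2 := by positivity
  have q1 : 0 < 1 / a := by positivity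
  have q2 : 0 < 1 / b := by positivity
  nlinarith [mul_le_mul_of_nonneg_right ha q1.le, mul_le_mul_of_nonneg_right hb q2.le,
    mul_pos p1 q2, mul_pos p2 q1]
end

section
/- Let d ≥ 1, σ > 0, μ, m₀ ∈ ℝ^d, and let Σ, Σ₀ be d×d symmetric positive-definite matrices. If X and Y are independent with X ∼ N(μ,Σ) and Y ∼ N(m₀,Σ₀), then E[exp(−2σ‖X−Y‖²)] = det(I_d+4σΣ+4σΣ₀)^{-1/2}·exp(−2σ·(μ−m₀)ᵀ(I_d+4σΣ+4σΣ₀)⁻¹(μ−m₀)), i.e. ∫∫exp(−2σ‖x−y‖²)dN(μ,Σ)(x)dN(m₀,Σ₀)(y) equals this expression. -/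
open MeasureTheory Matrix

theorem gauss_base {d : ℕ} (P : Matrix (Fin d) (Fin d) ℝ) (hP : P.PosDef) :
    ∫ y : Fin d → ℝ, Real.exp (-(1 / 2) * (y ⬝ᵥ (P *ᵥ y))) =
      ((2 * Real.pi) ^ d / P.det) ^ ((1 : ℝ) / 2) := by
  obtain ⟨B, hB⟩ : ∃ B : Matrix (Fin d) (Fin d) ℝ, P = Bᵀ * B := by
    open scoped MatrixOrder in
    obtain ⟨B, hB⟩ := CStarAlgebra.nonneg_iff_eq_star_mul_self.mp hP.posSemidef.nonneg
    exact ⟨B, by rw [hB, star_eq_conjTranspose, conjTranspose_eq_transpose_of_trivial]⟩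
  have hdet : P.det = B.det ^ 2 := by rw [hB, det_mul, det_transpose, sq]
  have hpos := hP.det_pos
  have hBdet : B.det ≠ 0 := by
    intro h; rw [hdet, h] at hpos; simp at hpos
  have hstd : ∫ z : Fin d → ℝ, Real.exp (-(1 / 2) * (z ⬝ᵥ z)) = √(2 * Real.pi) ^ d := by
    have h := integral_fintype_prod_volume_eq_pow (ι := Fin d)
      (fun x : ℝ => Real.exp (-(1 / 2) * x ^ 2))
    rw [integral_gaussian, Fintype.card_fin] at h
    rw [show Real.pi / (1 / 2) = 2 * Real.pi by ring] at h
    rw [← h]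
    congr 1; ext z
    rw [← Real.exp_sum, ← Finset.mul_sum]
    simp [dotProduct, sq]
  have hmap := Real.map_matrix_volume_pi_eq_smul_volume_pi hBdet
  have h1 : ∫ y : Fin d → ℝ, Real.exp (-(1 / 2) * (y ⬝ᵥ (P *ᵥ y))) =
      ∫ z, Real.exp (-(1 / 2) * (z ⬝ᵥ z)) ∂(Measure.map (toLin' B) volume) := by
    rw [integral_map]
    · congr 1; ext y
      rw [hB, toLin'_apply, ← mulVec_mulVec, dotProduct_mulVec, vecMul_transpose]
    · exact (LinearMap.continuous_of_finiteDimensional _).aemeasurable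
    · exact Continuous.aestronglyMeasurable (by unfold dotProduct; fun_prop)
  rw [h1, hmap, integral_smul_measure, hstd, ENNReal.toReal_ofReal (abs_nonneg _), hdet,
    ← Real.sqrt_eq_rpow, Real.sqrt_div (by positivity), Real.sqrt_sq_eq_abs, abs_inv,
    Real.sqrt_eq_rpow, Real.sqrt_eq_rpow, ← Real.rpow_natCast, ← Real.rpow_natCast,
    ← Real.rpow_mul (by positivity), ← Real.rpow_mul (by positivity), smul_eq_mul,
    mul_comm (d : ℝ)]
  ring

/-- Gaussian density. -/
noncomputable def gpdf {d : ℕ} (S : Matrix (Fin d) (Fin d) ℝ) (v : Fin d → ℝ) : ℝ :=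
  ((2 * Real.pi) ^ d * S.det) ^ (-(1 : ℝ) / 2) * Real.exp (-(1 / 2) * (v ⬝ᵥ (S⁻¹ *ᵥ v)))

theorem gpdf_neg {d : ℕ} (S : Matrix (Fin d) (Fin d) ℝ) (v : Fin d → ℝ) :
    gpdf S (-v) = gpdf S v := by
  simp [gpdf, mulVec_neg]

theorem integral_gm {d : ℕ} (m : Fin d → ℝ) (S : Matrix (Fin d) (Fin d) ℝ) (hS : S.PosDef)
    (f : (Fin d → ℝ) → ℝ) :
    ∫ x, f x ∂(gaussianMeasure m S) = ∫ x, gpdf S (x - m) * f x := by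
  have hpos := hS.det_pos
  unfold gaussianMeasure
  rw [integral_withDensity_eq_integral_toReal_smul]
  · congr 1; ext x
    rw [ENNReal.toReal_ofReal (by positivity)]
    rfl
  · apply Measurable.ennreal_ofReal
    apply Continuous.measurable
    unfold dotProduct mulVec dotProduct
    fun_prop
  · simp

theorem quad_id {d : ℕ} (A B : Matrix (Fin d) (Fin d) ℝ) (hA : A.PosDef) (hB : B.PosDef)
    (y w : Fin d → ℝ) :
    (y - A *ᵥ w) ⬝ᵥ (A⁻¹ *ᵥ (y - A *ᵥ w)) + (y + B *ᵥ w) ⬝ᵥ (B⁻¹ *ᵥ (y + B *ᵥ w)) =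
      y ⬝ᵥ ((A⁻¹ + B⁻¹) *ᵥ y) + ((A + B) *ᵥ w) ⬝ᵥ w := by
  have key : ∀ C : Matrix (Fin d) (Fin d) ℝ, C.PosDef →
      C⁻¹ *ᵥ (C *ᵥ w) = w ∧ (C *ᵥ w) ⬝ᵥ (C⁻¹ *ᵥ y) = w ⬝ᵥ y := by
    intro C hC
    have hu : IsUnit C.det := hC.det_pos.ne'.isUnit
    have hT : Cᵀ = C := by
      have := hC.isHermitian.eq
      rwa [conjTranspose_eq_transpose_of_trivial] at this
    refine ⟨by rw [mulVec_mulVec, nonsing_inv_mul _ hu, one_mulVec], ?_⟩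
    rw [dotProduct_comm, ← hT, mulVec_transpose, hT, dotProduct_comm, ← dotProduct_mulVec,
      mulVec_mulVec, mul_nonsing_inv _ hu, one_mulVec]
  obtain ⟨a1, a2⟩ := key A hA
  obtain ⟨b1, b2⟩ := key B hB
  simp only [mulVec_sub, mulVec_add, add_mulVec, sub_dotProduct, add_dotProduct, dotProduct_sub,
    dotProduct_add, a1, a2, b1, b2]
  rw [dotProduct_comm w y]
  ring

theorem gpdf_conv {d : ℕ} (A B : Matrix (Fin d) (Fin d) ℝ) (hA : A.PosDef) (hB : B.PosDef)
    (a b : Fin d → ℝ) :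
    ∫ x, gpdf A (x - a) * gpdf B (x - b) = gpdf (A + B) (a - b) := by
  have hAB := hA.add hB
  have hP := hA.inv.add hB.inv
  have hu : IsUnit (A + B).det := hAB.det_pos.ne'.isUnit
  have dA := hA.det_pos
  have dB := hB.det_pos
  have dAB := hAB.det_pos
  have dP := hP.det_pos
  set w := (A + B)⁻¹ *ᵥ (a - b) with hw
  have hv : a - b = (A + B) *ᵥ w := by
    rw [hw, mulVec_mulVec, mul_nonsing_inv _ hu, one_mulVec]
  have hdet : A.det * (A⁻¹ + B⁻¹).det * B.det = (A + B).det := by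
    rw [← det_mul, ← det_mul, mul_add, add_mul, mul_nonsing_inv _ dA.ne'.isUnit, Matrix.mul_assoc,
      nonsing_inv_mul _ dB.ne'.isUnit, one_mul, mul_one, add_comm]
  rw [← integral_add_right_eq_self _ (b + B *ᵥ w)]
  have e : ∀ y : Fin d → ℝ, gpdf A (y + (b + B *ᵥ w) - a) * gpdf B (y + (b + B *ᵥ w) - b) =
      (((2 * Real.pi) ^ d * A.det) ^ (-(1 : ℝ) / 2) * ((2 * Real.pi) ^ d * B.det) ^ (-(1 : ℝ) / 2)
        * Real.exp (-(1 / 2) * ((a - b) ⬝ᵥ w))) *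
      Real.exp (-(1 / 2) * (y ⬝ᵥ ((A⁻¹ + B⁻¹) *ᵥ y))) := by
    intro y
    have h1 : y + (b + B *ᵥ w) - a = y - A *ᵥ w := by
      have : a = b + (A *ᵥ w + B *ᵥ w) := by rw [← add_mulVec, ← hv]; abel
      rw [this]; abel
    have h2 : y + (b + B *ᵥ w) - b = y + B *ᵥ w := by abel
    have q := quad_id A B hA hB y w
    rw [← hv] at q
    rw [h1, h2, gpdf, gpdf, mul_mul_mul_comm, ← Real.exp_add, ← mul_add, q, mul_add, Real.exp_add]
    ring
  simp_rw [e]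
  rw [integral_const_mul, gauss_base _ hP, gpdf, ← hw, ← hdet]
  have hc : ((2 * Real.pi) ^ d * A.det) ^ (-(1 : ℝ) / 2) *
      ((2 * Real.pi) ^ d * B.det) ^ (-(1 : ℝ) / 2) *
      ((2 * Real.pi) ^ d / (A⁻¹ + B⁻¹).det) ^ ((1 : ℝ) / 2) =
      ((2 * Real.pi) ^ d * (A.det * (A⁻¹ + B⁻¹).det * B.det)) ^ (-(1 : ℝ) / 2) := by
    have : ((2 * Real.pi) ^ d / (A⁻¹ + B⁻¹).det) ^ ((1 : ℝ) / 2) =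
        ((A⁻¹ + B⁻¹).det / (2 * Real.pi) ^ d) ^ (-(1 : ℝ) / 2) := by
      rw [neg_div, Real.rpow_neg (by positivity), ← Real.inv_rpow (by positivity), inv_div]
    rw [this, ← Real.mul_rpow (by positivity) (by positivity),
      ← Real.mul_rpow (by positivity) (by positivity)]
    congr 1
    field_simp
  rw [← hc]
  ring

theorem stmt11 (d : ℕ) (hd : 1 ≤ d) (σ : ℝ) (hσ : 0 < σ) (μ m₀ : Fin d → ℝ)
    (S S₀ : Matrix (Fin d) (Fin d) ℝ) (hSsym : S.IsSymm) (hSpd : S.PosDef)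
    (hS₀sym : S₀.IsSymm) (hS₀pd : S₀.PosDef) :
    ∫ x, ∫ y, Real.exp (-(2 * σ) * ∑ i, (x i - y i) ^ 2)
        ∂(gaussianMeasure m₀ S₀) ∂(gaussianMeasure μ S) =
      ((1 : Matrix (Fin d) (Fin d) ℝ) + (4 * σ) • S + (4 * σ) • S₀).det ^ (-(1 : ℝ) / 2)
        * Real.exp (-(2 * σ) * ((μ - m₀) ⬝ᵥ
            (((1 : Matrix (Fin d) (Fin d) ℝ) + (4 * σ) • S + (4 * σ) • S₀)⁻¹ *ᵥ (μ - m₀)))) := by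
  have h4 : 0 < 4 * σ := by positivity
  have h4' : 0 < (4 * σ)⁻¹ := by positivity
  have hJ : ((4 * σ)⁻¹ • (1 : Matrix (Fin d) (Fin d) ℝ)).PosDef := PosDef.one.smul h4'
  have hM : ((1 : Matrix (Fin d) (Fin d) ℝ) + (4 * σ) • S + (4 * σ) • S₀).PosDef :=
    (PosDef.one.add (hSpd.smul h4)).add (hS₀pd.smul h4)
  have hinv : ∀ C : Matrix (Fin d) (Fin d) ℝ, C.PosDef →
      ((4 * σ)⁻¹ • C)⁻¹ = (4 * σ) • C⁻¹ := by
    intro C hC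
    apply inv_eq_right_inv
    rw [smul_mul_smul_comm, inv_mul_cancel₀ h4.ne', mul_nonsing_inv _ hC.det_pos.ne'.isUnit,
      one_smul]
  set k : ℝ := (2 * Real.pi) ^ d * (4 * σ)⁻¹ ^ d with hk
  have hkpos : 0 < k := by positivity
  have hg : ∀ C : Matrix (Fin d) (Fin d) ℝ, C.PosDef → ∀ v, gpdf ((4 * σ)⁻¹ • C) v =
      k ^ (-(1 : ℝ) / 2) * (C.det ^ (-(1 : ℝ) / 2) *
        Real.exp (-(2 * σ) * (v ⬝ᵥ (C⁻¹ *ᵥ v)))) := by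
    intro C hC v
    have := hC.det_pos
    rw [gpdf, hinv C hC, det_smul, Fintype.card_fin, ← mul_assoc, ← hk,
      Real.mul_rpow hkpos.le this.le, smul_mulVec, dotProduct_smul, smul_eq_mul]
    rw [show -(1 / 2) * (4 * σ * (v ⬝ᵥ (C⁻¹ *ᵥ v))) = -(2 * σ) * (v ⬝ᵥ (C⁻¹ *ᵥ v)) by ring]
    ring
  have hkk : k ^ ((1 : ℝ) / 2) * k ^ (-(1 : ℝ) / 2) = 1 := by
    rw [← Real.rpow_add hkpos]; norm_num
  have hker : ∀ x y : Fin d → ℝ, Real.exp (-(2 * σ) * ∑ i, (x i - y i) ^ 2) =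
      k ^ ((1 : ℝ) / 2) * gpdf ((4 * σ)⁻¹ • (1 : Matrix (Fin d) (Fin d) ℝ)) (y - x) := by
    intro x y
    rw [hg _ PosDef.one, ← mul_assoc, hkk, det_one, Real.one_rpow, inv_one, one_mulVec, one_mul,
      one_mul]
    congr 2
    apply Finset.sum_congr rfl
    intro i _
    simp only [Pi.sub_apply]
    ring
  have hinner : ∀ x : Fin d → ℝ, ∫ y, Real.exp (-(2 * σ) * ∑ i, (x i - y i) ^ 2)
        ∂(gaussianMeasure m₀ S₀) = k ^ ((1 : ℝ) / 2) *
        gpdf (S₀ + (4 * σ)⁻¹ • (1 : Matrix (Fin d) (Fin d) ℝ)) (x - m₀) := by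
    intro x
    rw [integral_gm _ _ hS₀pd, ← gpdf_neg, neg_sub, ← gpdf_conv _ _ hS₀pd hJ,
      ← integral_const_mul]
    congr 1; ext y
    rw [hker]; ring
  simp_rw [hinner]
  rw [integral_gm _ _ hSpd]
  simp_rw [mul_left_comm]
  rw [integral_const_mul, gpdf_conv _ _ hSpd (hS₀pd.add hJ)]
  have hsum : S + (S₀ + (4 * σ)⁻¹ • (1 : Matrix (Fin d) (Fin d) ℝ)) =
      (4 * σ)⁻¹ • ((1 : Matrix (Fin d) (Fin d) ℝ) + (4 * σ) • S + (4 * σ) • S₀) := by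
    simp only [smul_add, smul_smul, inv_mul_cancel₀ h4.ne', one_smul]
    abel
  rw [hsum, hg _ hM, ← mul_assoc, hkk, one_mul]
end
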